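/- arXiv:1709.04024 — 6 statements merged into one kernel-verified Lean document; each statement's English description precedes it below -/
import Mathlib

section
/- Let X and Y be finite sets and let p be a joint probability mass function on X × Y whose marginal p_X has full support on X. Define, for each probability mass function r on X with r ≠ p_X, the output distribution r_Y(y) = Σ_x r(x) p(y|x) where p(y|x) = p(x,y)/p_X(x). Then sup { D(r_Y ‖ p_Y) / D(r ‖ p_X) : r ≠ p_X } = 0 if and only if p(x,y) = p_X(x) p_Y(y) for all (x,y), i.e., if and only if X and Y are statistically independent. -/
open Finset Real

/-- Kullback–Leibler divergence between two probability mass functions on a finite set,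
with the convention `0 log 0 = 0` (automatic since `0 * x = 0` in `ℝ`). -/
noncomputable def Dkl {X : Type*} [Fintype X] (q q' : X → ℝ) : ℝ :=
  ∑ x, q x * Real.log (q x / q' x)

lemma kl_pt_strict {a b : ℝ} (ha : 0 ≤ a) (hb : 0 < b) (hab : a ≠ b) :
    a - b < a * Real.log (a / b) := by
  rcases ha.eq_or_lt with h | h
  · subst h; simpa using hb
  · have h1 : Real.log (b / a) < b / a - 1 := by
      apply Real.log_lt_sub_one_of_pos (div_pos hb h)
      intro h2
      rw [div_eq_one_iff_eq h.ne'] at h2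
      exact hab h2.symm
    have h2 : Real.log (a / b) = - Real.log (b / a) := by
      rw [← Real.log_inv, inv_div]
    have h3 := mul_lt_mul_of_pos_left h1 h
    have h4 : a * (b / a - 1) = b - a := by field_simp
    rw [h2]
    linarith

lemma kl_pt {a b : ℝ} (ha : 0 ≤ a) (hb : 0 < b) :
    a - b ≤ a * Real.log (a / b) := by
  by_cases h : a = b
  · subst h; simp [hb.ne']
  · exact (kl_pt_strict ha hb h).le

lemma Dkl_pos {X : Type*} [Fintype X] {q q' : X → ℝ} (h0 : ∀ x, 0 ≤ q x)
    (h0' : ∀ x, 0 ≤ q' x) (hac : ∀ x, q' x = 0 → q x = 0)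
    (hs : ∑ x, q x = ∑ x, q' x) (hne : q ≠ q') : 0 < Dkl q q' := by
  obtain ⟨x0, hx0⟩ := Function.ne_iff.mp hne
  have h1 : ∑ x, (q x - q' x) < ∑ x, q x * Real.log (q x / q' x) := by
    apply Finset.sum_lt_sum
    · intro x _
      rcases (h0' x).eq_or_lt with h | h
      · simp [hac x h.symm, ← h]
      · exact kl_pt (h0 x) h
    · refine ⟨x0, Finset.mem_univ _, ?_⟩
      rcases (h0' x0).eq_or_lt with h | h
      · exact absurd ((hac x0 h.symm).trans h) hx0
      · exact kl_pt_strict (h0 x0) h hx0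
  rw [Finset.sum_sub_distrib, hs, sub_self] at h1
  exact h1

/-- Data processing inequality for a channel `W` from `X` to `Y`. -/
lemma Dkl_dpi {X Y : Type*} [Fintype X] [Fintype Y] (W : X → Y → ℝ) (r q : X → ℝ)
    (hW0 : ∀ x y, 0 ≤ W x y) (hW1 : ∀ x, ∑ y, W x y = 1) (hr : ∀ x, 0 ≤ r x)
    (hq : ∀ x, 0 < q x) :
    Dkl (fun y => ∑ x, r x * W x y) (fun y => ∑ x, q x * W x y) ≤ Dkl r q := by
  have key : ∀ y, (∑ x, r x * W x y) * Real.log ((∑ x, r x * W x y) / ∑ x, q x * W x y)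
      ≤ ∑ x, (r x * Real.log (r x / q x)) * W x y := by
    intro y
    have hA0 : ∀ x ∈ Finset.univ, 0 ≤ r x * W x y := fun x _ => mul_nonneg (hr x) (hW0 x y)
    have hB0 : ∀ x ∈ Finset.univ, 0 ≤ q x * W x y :=
      fun x _ => mul_nonneg (hq x).le (hW0 x y)
    have hA := Finset.sum_nonneg hA0
    have hB := Finset.sum_nonneg hB0
    rcases hA.eq_or_lt with h | h
    · rw [← h, zero_mul]
      apply le_of_eq
      symm
      apply Finset.sum_eq_zero
      intro x hx
      have := (Finset.sum_eq_zero_iff_of_nonneg hA0).mp h.symm x hx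
      linear_combination Real.log (r x / q x) * this
    · have hBp : 0 < ∑ x, q x * W x y := by
        apply hB.lt_of_ne
        intro hz
        have hz' := (Finset.sum_eq_zero_iff_of_nonneg hB0).mp hz.symm
        apply h.ne
        symm
        apply Finset.sum_eq_zero
        intro x hx
        have := (mul_eq_zero.mp (hz' x hx)).resolve_left (hq x).ne'
        rw [this, mul_zero]
      set A := ∑ x, r x * W x y with hAd
      set B := ∑ x, q x * W x y with hBd
      have hc : 0 < A / B := div_pos h hBp
      have h1 : ∀ x ∈ Finset.univ, (r x * W x y) - (q x * W x y) * (A / B)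
          ≤ (r x * Real.log (r x / q x)) * W x y - (r x * W x y) * Real.log (A / B) := by
        intro x _
        have h2 : r x - q x * (A / B)
            ≤ r x * (Real.log (r x / q x) - Real.log (A / B)) := by
          rcases (hr x).eq_or_lt with h3 | h3
          · rw [← h3]
            have := mul_pos (hq x) hc
            linarith
          · have h4 := kl_pt (hr x) (mul_pos (hq x) hc)
            rwa [← div_div, Real.log_div (div_pos h3 (hq x)).ne' hc.ne'] at h4
        have := mul_le_mul_of_nonneg_right h2 (hW0 x y)
        linarith
      have h2 := Finset.sum_le_sum h1
      rw [Finset.sum_sub_distrib, Finset.sum_sub_distrib, ← Finset.sum_mul, ← Finset.sum_mul,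
        ← hAd, ← hBd, mul_div_cancel₀ _ hBp.ne'] at h2
      linarith
  unfold Dkl
  calc _ ≤ ∑ y, ∑ x, (r x * Real.log (r x / q x)) * W x y :=
        Finset.sum_le_sum fun y _ => key y
    _ = _ := by
        rw [Finset.sum_comm]
        refine Finset.sum_congr rfl fun x _ => ?_
        rw [← Finset.mul_sum, hW1, mul_one]

/-- **The hypercontractivity coefficient vanishes iff `X` and `Y` are independent.**
For a joint pmf `p` on a finite set `X × Y` whose marginal `p_X` has full support,
`sup { D(r_Y ‖ p_Y) / D(r ‖ p_X) : r ≠ p_X } = 0` iff `p(x,y) = p_X(x) p_Y(y)` for all `x, y`. -/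
theorem hc_eq_zero_iff_indep {X Y : Type*} [Fintype X] [Fintype Y] [Nonempty X] [Nonempty Y]
    (p : X × Y → ℝ) (hp0 : ∀ z, 0 ≤ p z) (hp1 : ∑ z, p z = 1)
    (pX : X → ℝ) (hpX : ∀ x, pX x = ∑ y, p (x, y))
    (pY : Y → ℝ) (hpY : ∀ y, pY y = ∑ x, p (x, y))
    (hfull : ∀ x, 0 < pX x) :
    sSup { t : ℝ | ∃ r : X → ℝ, (∀ x, 0 ≤ r x) ∧ (∑ x, r x) = 1 ∧ r ≠ pX ∧
        t = Dkl (fun y => ∑ x, r x * (p (x, y) / pX x)) pY / Dkl r pX } = 0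
      ↔ ∀ x y, p (x, y) = pX x * pY y := by
  classical
  have hX1 : ∑ x, pX x = 1 := by
    rw [← hp1, Fintype.sum_prod_type]
    exact Finset.sum_congr rfl fun x _ => hpX x
  have hY1 : ∑ y, pY y = 1 := by
    rw [← hp1, Fintype.sum_prod_type_right]
    exact Finset.sum_congr rfl fun y _ => hpY y
  have hW0 : ∀ x y, 0 ≤ p (x, y) / pX x := fun x y => div_nonneg (hp0 _) (hfull x).le
  have hW1 : ∀ x, ∑ y, p (x, y) / pX x = 1 := by
    intro x
    rw [← Finset.sum_div, ← hpX, div_self (hfull x).ne']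
  have hq : ∀ x y, pX x * (p (x, y) / pX x) = p (x, y) := fun x y =>
    mul_div_cancel₀ _ (hfull x).ne'
  have hYq : pY = fun y => ∑ x, pX x * (p (x, y) / pX x) := by
    funext y
    rw [hpY]
    exact Finset.sum_congr rfl fun x _ => (hq x y).symm
  have hDpos : ∀ r : X → ℝ, (∀ x, 0 ≤ r x) → (∑ x, r x) = 1 → r ≠ pX → 0 < Dkl r pX := by
    intro r h0 h1 hne
    exact Dkl_pos h0 (fun x => (hfull x).le) (fun x h => absurd h (hfull x).ne')
      (h1.trans hX1.symm) hne
  constructor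
  · intro hs
    have hbdd : BddAbove { t : ℝ | ∃ r : X → ℝ, (∀ x, 0 ≤ r x) ∧ (∑ x, r x) = 1 ∧ r ≠ pX ∧
        t = Dkl (fun y => ∑ x, r x * (p (x, y) / pX x)) pY / Dkl r pX } := by
      refine ⟨1, ?_⟩
      rintro t ⟨r, h0, h1, hne, rfl⟩
      rw [div_le_one (hDpos r h0 h1 hne)]
      have := Dkl_dpi (fun x y => p (x, y) / pX x) r pX hW0 hW1 h0 hfull
      rw [hYq]
      exact this
    have main : ∀ r : X → ℝ, (∀ x, 0 ≤ r x) → (∑ x, r x) = 1 →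
        (fun y => ∑ x, r x * (p (x, y) / pX x)) = pY := by
      intro r h0 h1
      by_cases hne : r = pX
      · rw [hne]; exact hYq.symm
      by_contra hc
      have hle := le_csSup hbdd ⟨r, h0, h1, hne, rfl⟩
      rw [hs] at hle
      have hpos : 0 < Dkl (fun y => ∑ x, r x * (p (x, y) / pX x)) pY := by
        apply Dkl_pos _ _ _ _ hc
        · exact fun y => Finset.sum_nonneg fun x _ => mul_nonneg (h0 x) (hW0 x y)
        · intro y; rw [hpY]; exact Finset.sum_nonneg fun x _ => hp0 _
        · intro y hy
          rw [hpY, Finset.sum_eq_zero_iff_of_nonneg (fun x _ => hp0 _)] at hy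
          apply Finset.sum_eq_zero
          intro x hx
          rw [hy x hx, zero_div, mul_zero]
        · rw [hY1, Finset.sum_comm, ← h1]
          refine Finset.sum_congr rfl fun x _ => ?_
          rw [← Finset.mul_sum, hW1, mul_one]
      exact absurd hle (not_le.mpr (div_pos hpos (hDpos r h0 h1 hne)))
    intro x0 y
    have h := congrFun (main (fun x => if x = x0 then 1 else 0)
      (fun x => by split_ifs <;> norm_num) (by simp)) y
    simp only [ite_mul, one_mul, zero_mul, Finset.sum_ite_eq', Finset.sum_ite_eq,
      Finset.mem_univ, if_true] at h
    rw [← h, hq]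
  · intro hind
    have hz : ∀ t ∈ { t : ℝ | ∃ r : X → ℝ, (∀ x, 0 ≤ r x) ∧ (∑ x, r x) = 1 ∧ r ≠ pX ∧
        t = Dkl (fun y => ∑ x, r x * (p (x, y) / pX x)) pY / Dkl r pX }, t = 0 := by
      rintro t ⟨r, h0, h1, hne, rfl⟩
      have hY : (fun y => ∑ x, r x * (p (x, y) / pX x)) = pY := by
        funext y
        have : ∀ x ∈ Finset.univ, r x * (p (x, y) / pX x) = r x * pY y := by
          intro x _
          rw [hind, mul_div_cancel_left₀ _ (hfull x).ne']
        rw [Finset.sum_congr rfl this, ← Finset.sum_mul, h1, one_mul]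
      have h2 : Dkl pY pY = 0 := by
        unfold Dkl
        apply Finset.sum_eq_zero
        intro y _
        by_cases h : pY y = 0
        · rw [h, zero_mul]
        · rw [div_self h, Real.log_one, mul_zero]
      rw [hY, h2, zero_div]
    apply le_antisymm
    · exact Real.sSup_nonpos fun t ht => (hz t ht).le
    · exact Real.sSup_nonneg fun t ht => (hz t ht).ge
end

section
/- Let X and Y be real-valued random variables, and let f, g : ℝ → ℝ be Borel-measurable bijections with Borel-measurable inverses. Then the hypercontractivity coefficient is invariant under these transformations: s(f(X); g(Y)) = s(X; Y). -/
open MeasureTheory ProbabilityTheory Real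

/-- Kullback–Leibler divergence between two measures, valued in the extended reals. -/
noncomputable def klDivE {α : Type*} [MeasurableSpace α] (μ ν : Measure α) : EReal :=
  open Classical in
  if μ ≪ ν ∧ Integrable (llr μ ν) μ then ((∫ x, llr μ ν x ∂μ : ℝ) : EReal) else ⊤

/-- Mutual information `I(U;X) = D(law(U,X) ‖ law U ⊗ law X)`. -/
noncomputable def mutInfoE {Ω α β : Type*} [MeasurableSpace Ω] [MeasurableSpace α]
    [MeasurableSpace β] (U : Ω → α) (X : Ω → β) (P : Measure Ω) : EReal :=
  klDivE (P.map (fun ω => (U ω, X ω))) ((P.map U).prod (P.map X))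

/-- A witness for the supremum defining the hypercontractivity coefficient of a joint law `μ`
on `ℝ × ℝ`: a random variable `U` with values in an arbitrary measurable space, defined on a
(possibly enlarged) probability space carrying random variables `X`, `Y` whose joint law is `μ`,
such that `U — X — Y` is a Markov chain (i.e. `U` and `Y` are conditionally independent
given `X`). -/
structure MarkovWitness (μ : Measure (ℝ × ℝ)) where
  (Ω : Type)
  [mΩ : MeasurableSpace Ω]
  [sb : StandardBorelSpace Ω]
  (P : Measure Ω)
  [probP : IsProbabilityMeasure P]
  (A : Type)
  [mA : MeasurableSpace A]
  (U : Ω → A)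
  (X : Ω → ℝ)
  (Y : Ω → ℝ)
  (measU : Measurable U)
  (measX : Measurable X)
  (measY : Measurable Y)
  (law_eq : P.map (fun ω => (X ω, Y ω)) = μ)
  (markov : CondIndepFun (MeasurableSpace.comap X inferInstance) measX.comap_le U Y P)

attribute [instance] MarkovWitness.mΩ MarkovWitness.sb MarkovWitness.probP MarkovWitness.mA

/-- The hypercontractivity coefficient `s(X;Y) = sup I(U;Y)/I(U;X)`, the supremum over all `U`
(on a possibly enlarged probability space) such that `U — X — Y` is a Markov chain and
`0 < I(U;X) < ∞`. -/
noncomputable def hc {Ω : Type*} [MeasurableSpace Ω] (P : Measure Ω) (X Y : Ω → ℝ) : ℝ :=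
  sSup { t | ∃ w : MarkovWitness (P.map (fun ω => (X ω, Y ω))),
    0 < mutInfoE w.U w.X w.P ∧ mutInfoE w.U w.X w.P < ⊤ ∧
    t = (mutInfoE w.U w.Y w.P).toReal / (mutInfoE w.U w.X w.P).toReal }

/-- Divergence is invariant under a measurable equivalence. -/
theorem klDivE_map_equiv {α β : Type*} [MeasurableSpace α] [MeasurableSpace β]
    (e : α ≃ᵐ β) (μ ν : Measure α) [IsFiniteMeasure μ] [IsFiniteMeasure ν] :
    klDivE (μ.map e) (ν.map e) = klDivE μ ν := by
  have hac : μ.map e ≪ ν.map e ↔ μ ≪ ν := by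
    refine ⟨fun h => ?_, fun h => h.map e.measurable⟩
    have h2 := h.map e.symm.measurable
    simpa using h2
  unfold klDivE
  by_cases h : μ ≪ ν
  · have hll : (fun x => llr (μ.map e) (ν.map e) (e x)) =ᵐ[μ] llr μ ν := by
      have h1 := h.ae_le (e.measurableEmbedding.rnDeriv_map μ ν)
      filter_upwards [h1] with x hx
      simp only [llr]
      rw [hx]
    have hint : Integrable (llr (μ.map e) (ν.map e)) (μ.map e) ↔ Integrable (llr μ ν) μ := by
      rw [integrable_map_equiv]
      exact integrable_congr hll
    have hval : ∫ x, llr (μ.map e) (ν.map e) x ∂(μ.map e) = ∫ x, llr μ ν x ∂μ := by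
      rw [integral_map_equiv]
      exact integral_congr_ae hll
    rw [hval]
    classical
    exact if_congr (and_congr hac hint) rfl rfl
  · rw [if_neg (fun h' => h (hac.1 h'.1)), if_neg (fun h' => h h'.1)]

/-- Mutual information is invariant under a measurable equivalence of the second variable. -/
theorem mutInfoE_comp_equiv {Ω α β γ : Type*} [MeasurableSpace Ω] [MeasurableSpace α]
    [MeasurableSpace β] [MeasurableSpace γ] (e : β ≃ᵐ γ) (U : Ω → α) (X : Ω → β)
    (hU : Measurable U) (hX : Measurable X) (P : Measure Ω) [IsProbabilityMeasure P] :
    mutInfoE U (fun ω => e (X ω)) P = mutInfoE U X P := by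
  have := Measure.isProbabilityMeasure_map (μ := P) hU.aemeasurable
  have := Measure.isProbabilityMeasure_map (μ := P) hX.aemeasurable
  have := Measure.isProbabilityMeasure_map (μ := P) (hU.prodMk hX).aemeasurable
  unfold mutInfoE
  rw [← klDivE_map_equiv ((MeasurableEquiv.refl α).prodCongr e)
    (P.map (fun ω => (U ω, X ω))) ((P.map U).prod (P.map X))]
  have h1 : P.map (fun ω => (U ω, e (X ω))) =
      (P.map (fun ω => (U ω, X ω))).map ((MeasurableEquiv.refl α).prodCongr e) := by
    rw [Measure.map_map (MeasurableEquiv.measurable _) (hU.prodMk hX)]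
    rfl
  have h2 : (P.map U).prod (P.map (fun ω => e (X ω))) =
      ((P.map U).prod (P.map X)).map ((MeasurableEquiv.refl α).prodCongr e) := by
    have h3 : P.map (fun ω => e (X ω)) = (P.map X).map e := by
      rw [Measure.map_map e.measurable hX]
      rfl
    rw [h3]
    have h4 := Measure.map_prod_map (P.map U) (P.map X) measurable_id e.measurable
    rw [Measure.map_id] at h4
    exact h4
  rw [h1, h2]

/-- Transport of a witness along measurable equivalences. -/
noncomputable def MarkovWitness.transport {μ : Measure (ℝ × ℝ)} (w : MarkovWitness μ)
    (e d : ℝ ≃ᵐ ℝ) : MarkovWitness (μ.map (fun p => (e p.1, d p.2))) where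
  Ω := w.Ω
  P := w.P
  A := w.A
  U := w.U
  X := fun ω => e (w.X ω)
  Y := fun ω => d (w.Y ω)
  measU := w.measU
  measX := e.measurable.comp w.measX
  measY := d.measurable.comp w.measY
  law_eq := by
    conv_rhs => rw [← w.law_eq]
    rw [Measure.map_map (by fun_prop) (w.measX.prodMk w.measY)]
    rfl
  markov := by
    have h := w.markov.comp measurable_id d.measurable
    have hc : MeasurableSpace.comap (fun ω => e (w.X ω)) inferInstance =
        MeasurableSpace.comap w.X inferInstance := by
      have h1 := congrArg (MeasurableSpace.comap w.X) e.measurableEmbedding.comap_eq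
      rw [MeasurableSpace.comap_comp] at h1
      exact h1
    convert h using 1
    all_goals rfl

/-- One inclusion between the sets of ratios. -/
theorem hc_set_subset {μ ν : Measure (ℝ × ℝ)} (e d : ℝ ≃ᵐ ℝ)
    (hν : μ.map (fun p => (e p.1, d p.2)) = ν) :
    { t : ℝ | ∃ w : MarkovWitness μ,
      0 < mutInfoE w.U w.X w.P ∧ mutInfoE w.U w.X w.P < ⊤ ∧
      t = (mutInfoE w.U w.Y w.P).toReal / (mutInfoE w.U w.X w.P).toReal } ⊆
    { t : ℝ | ∃ w : MarkovWitness ν,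
      0 < mutInfoE w.U w.X w.P ∧ mutInfoE w.U w.X w.P < ⊤ ∧
      t = (mutInfoE w.U w.Y w.P).toReal / (mutInfoE w.U w.X w.P).toReal } := by
  subst hν
  rintro t ⟨w, h0, h1, h2⟩
  have hX : mutInfoE (w.transport e d).U (w.transport e d).X (w.transport e d).P =
      mutInfoE w.U w.X w.P := mutInfoE_comp_equiv e w.U w.X w.measU w.measX w.P
  have hY : mutInfoE (w.transport e d).U (w.transport e d).Y (w.transport e d).P =
      mutInfoE w.U w.Y w.P := mutInfoE_comp_equiv d w.U w.Y w.measU w.measY w.P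
  exact ⟨w.transport e d, by rw [hX]; exact h0, by rw [hX]; exact h1, by rw [hX, hY]; exact h2⟩

/-- **Invariance of the hypercontractivity coefficient under bijective Borel transformations.**
If `f, g : ℝ → ℝ` are Borel-measurable bijections with Borel-measurable inverses, then
`s(f(X); g(Y)) = s(X; Y)`. -/
theorem hc_comp_bijective {Ω : Type*} [MeasurableSpace Ω] (P : Measure Ω)
    [IsProbabilityMeasure P] (X Y : Ω → ℝ) (hX : Measurable X) (hY : Measurable Y)
    (f g : ℝ → ℝ) (hf : Measurable f) (hg : Measurable g)
    (hfb : Function.Bijective f) (hgb : Function.Bijective g)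
    (hfinv : Measurable (Function.invFun f)) (hginv : Measurable (Function.invFun g)) :
    hc P (fun ω => f (X ω)) (fun ω => g (Y ω)) = hc P X Y := by
  let e : ℝ ≃ᵐ ℝ :=
    { toFun := f
      invFun := Function.invFun f
      left_inv := Function.leftInverse_invFun hfb.1
      right_inv := Function.rightInverse_invFun hfb.2
      measurable_toFun := hf
      measurable_invFun := hfinv }
  let d : ℝ ≃ᵐ ℝ :=
    { toFun := g
      invFun := Function.invFun g
      left_inv := Function.leftInverse_invFun hgb.1
      right_inv := Function.rightInverse_invFun hgb.2
      measurable_toFun := hg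
      measurable_invFun := hginv }
  unfold hc
  congr 1
  apply Set.Subset.antisymm
  · refine hc_set_subset e.symm d.symm ?_
    rw [Measure.map_map (by fun_prop) (by fun_prop)]
    congr 1
    funext ω
    exact Prod.ext (e.symm_apply_apply (X ω)) (d.symm_apply_apply (Y ω))
  · refine hc_set_subset e d ?_
    rw [Measure.map_map (by fun_prop) (by fun_prop)]
    rfl
end

section
/- Let ρ ∈ (−1, 1) with ρ ≠ 0, and let (X, Y) be jointly Gaussian: X ∼ N(0,1) and Y = ρX + W where W ∼ N(0, 1−ρ²) is independent of X. Then the hypercontractivity coefficient satisfies s(X;Y) = ρ². In particular, √(s(X;Y)) = |ρ| equals the absolute value of the Pearson correlation coefficient of (X,Y). -/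
open MeasureTheory ProbabilityTheory Real

section HcgAux

open Filter Topology

lemma hcg_sinh_aux (r b : ℝ) (hr0 : 0 < r) (hr1 : r < 1) (hb : 0 ≤ b) :
    0 ≤ Real.sinh b * Real.cosh (b / r) - r * Real.sinh (b / r) * Real.cosh b := by
  have hd : ∀ x : ℝ, HasDerivAt
      (fun x => Real.sinh x * Real.cosh (x / r) - r * Real.sinh (x / r) * Real.cosh x)
      ((1 / r - r) * (Real.sinh x * Real.sinh (x / r))) x := by
    intro x
    have h1 : HasDerivAt (fun x : ℝ => x / r) (1 / r) x := (hasDerivAt_id x).div_const r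
    have := ((Real.hasDerivAt_sinh x).mul h1.cosh).sub ((h1.sinh.const_mul r).mul
      (Real.hasDerivAt_cosh x))
    convert! this using 1
    field_simp
    ring
  have hm : MonotoneOn
      (fun x => Real.sinh x * Real.cosh (x / r) - r * Real.sinh (x / r) * Real.cosh x)
      (Set.Ici 0) := by
    apply monotoneOn_of_deriv_nonneg (convex_Ici 0)
    · exact fun x _ => (hd x).continuousAt.continuousWithinAt
    · exact fun x _ => (hd x).differentiableAt.differentiableWithinAt
    · intro x hx
      simp only [interior_Ici, Set.mem_Ioi] at hx
      rw [(hd x).deriv]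
      have h1 : 0 ≤ 1 / r - r := by
        have : 1 ≤ 1 / r := by rw [le_div_iff₀ hr0]; linarith
        linarith
      have h2 : 0 ≤ Real.sinh x := Real.sinh_nonneg_iff.2 hx.le
      have h3 : 0 ≤ Real.sinh (x / r) := Real.sinh_nonneg_iff.2 (by positivity)
      positivity
  have := hm (Set.mem_Ici.2 le_rfl) (Set.mem_Ici.2 hb) hb
  simpa using this

lemma hcg_logcosh (r b : ℝ) (hr0 : 0 < r) (hr1 : r < 1) (hb : 0 ≤ b) :
    r ^ 2 * Real.log (Real.cosh (b / r)) ≤ Real.log (Real.cosh b) := by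
  have hd : ∀ x : ℝ, HasDerivAt
      (fun x => Real.log (Real.cosh x) - r ^ 2 * Real.log (Real.cosh (x / r)))
      (Real.sinh x / Real.cosh x - r * Real.sinh (x / r) / Real.cosh (x / r)) x := by
    intro x
    have h1 : HasDerivAt (fun x : ℝ => x / r) (1 / r) x := (hasDerivAt_id x).div_const r
    have := ((Real.hasDerivAt_cosh x).log (Real.cosh_pos x).ne').sub
      ((h1.cosh.log (Real.cosh_pos _).ne').const_mul (r ^ 2))
    convert! this using 1
    field_simp
  have hm : MonotoneOn
      (fun x => Real.log (Real.cosh x) - r ^ 2 * Real.log (Real.cosh (x / r)))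
      (Set.Ici 0) := by
    apply monotoneOn_of_deriv_nonneg (convex_Ici 0)
    · exact fun x _ => (hd x).continuousAt.continuousWithinAt
    · exact fun x _ => (hd x).differentiableAt.differentiableWithinAt
    · intro x hx
      simp only [interior_Ici, Set.mem_Ioi] at hx
      rw [(hd x).deriv, div_sub_div _ _ (Real.cosh_pos _).ne' (Real.cosh_pos _).ne']
      have := hcg_sinh_aux r x hr0 hr1 hx.le
      apply div_nonneg _ (by have := Real.cosh_pos x; have := Real.cosh_pos (x / r); positivity)
      linarith
  have := hm (Set.mem_Ici.2 le_rfl) (Set.mem_Ici.2 hb) hb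
  simp only [Real.cosh_zero, Real.log_one, zero_div, mul_zero, sub_zero] at this
  linarith

lemma hcg_cosh (ρ b : ℝ) (hρ : ρ ∈ Set.Ioo (-1 : ℝ) 1) (hρ0 : ρ ≠ 0) :
    Real.cosh (b / ρ) ≤ Real.cosh b ^ (1 / ρ ^ 2) := by
  have h := hcg_logcosh |ρ| |b| (abs_pos.2 hρ0) (abs_lt.2 hρ) (abs_nonneg b)
  rw [← abs_div, Real.cosh_abs, Real.cosh_abs, sq_abs] at h
  have h2 : (0:ℝ) < ρ ^ 2 := by positivity
  rw [← Real.log_le_log_iff (Real.cosh_pos _) (Real.rpow_pos_of_pos (Real.cosh_pos _) _),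
    Real.log_rpow (Real.cosh_pos _), one_div, inv_mul_eq_div, le_div_iff₀ h2]
  linarith

/-- The plane with its Euclidean norm. -/
abbrev HcgE := WithLp 2 (ℝ × ℝ)

/-- Dual (linearised) form of the entropy contraction property of a joint law. -/
def HcgP (c : ℝ) (μ : Measure HcgE) : Prop :=
  ∀ H g : ℝ → ℝ, Measurable H → Measurable g → (∃ C, ∀ x, |H x| ≤ C) → (∃ C, ∀ x, |g x| ≤ C) →
    ∫ z, Real.exp (H z.fst) * (1 - H z.fst + c * g z.snd) ∂μ ≤
      (∫ z, Real.exp (g z.snd) ∂μ) ^ c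

/-- The two-point joint law. -/
noncomputable def hcgTwo (ρ : ℝ) : Measure HcgE :=
  ENNReal.ofReal ((1 + ρ) / 4) • Measure.dirac (WithLp.toLp 2 (1, 1)) +
  ENNReal.ofReal ((1 + ρ) / 4) • Measure.dirac (WithLp.toLp 2 (-1, -1)) +
  ENNReal.ofReal ((1 - ρ) / 4) • Measure.dirac (WithLp.toLp 2 (1, -1)) +
  ENNReal.ofReal ((1 - ρ) / 4) • Measure.dirac (WithLp.toLp 2 (-1, 1))

lemma hcgTwo_prob (ρ : ℝ) (hρ : ρ ∈ Set.Ioo (-1 : ℝ) 1) : IsProbabilityMeasure (hcgTwo ρ) := by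
  constructor
  have h1 : 0 ≤ (1 + ρ) / 4 := by linarith [hρ.1]
  have h2 : 0 ≤ (1 - ρ) / 4 := by linarith [hρ.2]
  simp only [hcgTwo, Measure.coe_add, Measure.coe_smul, Pi.add_apply, Pi.smul_apply, measure_univ,
    smul_eq_mul, mul_one]
  rw [← ENNReal.ofReal_add h1 h1, ← ENNReal.ofReal_add (by positivity) h2,
    ← ENNReal.ofReal_add (by positivity) h2, ← ENNReal.ofReal_one]
  congr 1
  ring

lemma hcgTwo_integral {F : Type*} [NormedAddCommGroup F] [NormedSpace ℝ F] [CompleteSpace F]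
    (ρ : ℝ) (hρ : ρ ∈ Set.Ioo (-1 : ℝ) 1) (f : HcgE → F) :
    ∫ z, f z ∂(hcgTwo ρ) = ((1 + ρ) / 4) • f (WithLp.toLp 2 (1, 1)) +
      ((1 + ρ) / 4) • f (WithLp.toLp 2 (-1, -1)) + ((1 - ρ) / 4) • f (WithLp.toLp 2 (1, -1)) +
      ((1 - ρ) / 4) • f (WithLp.toLp 2 (-1, 1)) := by
  have h1 : 0 ≤ (1 + ρ) / 4 := by linarith [hρ.1]
  have h2 : 0 ≤ (1 - ρ) / 4 := by linarith [hρ.2]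
  have hi : ∀ (a : ℝ) (x : HcgE), Integrable f (ENNReal.ofReal a • Measure.dirac x) := by
    intro a x
    exact (integrable_dirac (by simp)).smul_measure (by simp)
  unfold hcgTwo
  rw [integral_add_measure (((hi _ _).add_measure (hi _ _)).add_measure (hi _ _)) (hi _ _),
    integral_add_measure ((hi _ _).add_measure (hi _ _)) (hi _ _),
    integral_add_measure (hi _ _) (hi _ _)]
  simp only [integral_smul_measure, integral_dirac, ENNReal.toReal_ofReal h1,
    ENNReal.toReal_ofReal h2]

lemma hcg_exp_tangent (h a : ℝ) : Real.exp h * (1 - h + a) ≤ Real.exp a := by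
  have h1 := Real.add_one_le_exp (a - h)
  have h2 : Real.exp a = Real.exp h * Real.exp (a - h) := by rw [← Real.exp_add]; ring_nf
  rw [h2]
  apply mul_le_mul_of_nonneg_left _ (Real.exp_pos h).le
  linarith

lemma hcgP_two (ρ : ℝ) (hρ : ρ ∈ Set.Ioo (-1 : ℝ) 1) (hρ0 : ρ ≠ 0) :
    HcgP (1 / ρ ^ 2) (hcgTwo ρ) := by
  intro H g _ _ _ _
  rw [hcgTwo_integral ρ hρ, hcgTwo_integral ρ hρ]
  simp only [smul_eq_mul, WithLp.toLp_fst, WithLp.toLp_snd]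
  obtain ⟨a, ha⟩ : ∃ a, a = (g 1 + g (-1)) / 2 := ⟨_, rfl⟩
  obtain ⟨b, hb⟩ : ∃ b, b = (g 1 - g (-1)) / 2 := ⟨_, rfl⟩
  have e1 : g 1 = a + b := by rw [ha, hb]; ring
  have e2 : g (-1) = a - b := by rw [ha, hb]; ring
  rw [e1, e2]
  set c := 1 / ρ ^ 2 with hc
  have t1 := hcg_exp_tangent (H 1) (c * (a + ρ * b))
  have t2 := hcg_exp_tangent (H (-1)) (c * (a - ρ * b))
  have hcb : c * (ρ * b) = b / ρ := by rw [hc]; field_simp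
  have hr : (1 + ρ) / 4 * Real.exp (a + b) + (1 + ρ) / 4 * Real.exp (a - b) +
      (1 - ρ) / 4 * Real.exp (a - b) + (1 - ρ) / 4 * Real.exp (a + b)
      = Real.exp a * Real.cosh b := by
    rw [Real.cosh_eq, sub_eq_add_neg a b, Real.exp_add, Real.exp_add]; ring
  rw [hr, Real.mul_rpow (Real.exp_pos a).le (Real.cosh_pos b).le, ← Real.exp_mul]
  have t3 : Real.exp (c * (a + ρ * b)) + Real.exp (c * (a - ρ * b))
      = 2 * (Real.exp (a * c) * Real.cosh (b / ρ)) := by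
    rw [mul_add, mul_sub, hcb, sub_eq_add_neg, Real.exp_add, Real.exp_add, Real.cosh_eq,
      mul_comm c a]; ring
  have t4 := mul_le_mul_of_nonneg_left (hcg_cosh ρ b hρ hρ0) (Real.exp_pos (a * c)).le
  rw [← hc] at t4
  linarith

lemma hcg_integrand_bound {c h g C D : ℝ} (hh : |h| ≤ C) (hg : |g| ≤ D) :
    |Real.exp h * (1 - h + c * g)| ≤ Real.exp C * (1 + C + |c| * D) := by
  rw [abs_mul, abs_of_pos (Real.exp_pos h)]
  have h1 : |1 - h + c * g| ≤ 1 + C + |c| * D := by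
    calc |1 - h + c * g| ≤ |1 - h| + |c * g| := abs_add_le _ _
      _ ≤ (|1| + |h|) + |c| * |g| := by rw [abs_mul]; gcongr; exact abs_sub _ _
      _ ≤ 1 + C + |c| * D := by rw [abs_one]; gcongr
  exact mul_le_mul (Real.exp_le_exp.2 ((le_abs_self h).trans hh)) h1 (abs_nonneg _)
    (Real.exp_pos _).le

lemma hcg_abs_log {a C : ℝ} (h1 : Real.exp (-C) ≤ a) (h2 : a ≤ Real.exp C) : |Real.log a| ≤ C := by
  have ha : 0 < a := (Real.exp_pos _).trans_le h1
  rw [abs_le]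
  exact ⟨(Real.le_log_iff_exp_le ha).2 h1, (Real.log_le_iff_le_exp ha).2 h2⟩

lemma hcg_exp_int_bounds {α : Type*} [MeasurableSpace α] (ν : Measure α) [IsProbabilityMeasure ν]
    {f : α → ℝ} {C : ℝ} (hf : Measurable f) (hC : ∀ x, |f x| ≤ C) :
    Real.exp (-C) ≤ ∫ x, Real.exp (f x) ∂ν ∧ ∫ x, Real.exp (f x) ∂ν ≤ Real.exp C := by
  have hi : Integrable (fun x => Real.exp (f x)) ν := by
    apply Integrable.of_bound (C := Real.exp C) (by fun_prop)
    filter_upwards with x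
    rw [Real.norm_eq_abs, abs_of_pos (Real.exp_pos _)]
    exact Real.exp_le_exp.2 ((le_abs_self _).trans (hC x))
  constructor
  · have := integral_mono (μ := ν) (integrable_const (Real.exp (-C))) hi
      (fun x => Real.exp_le_exp.2 (abs_le.1 (hC x)).1)
    simpa using this
  · have := integral_mono (μ := ν) hi (integrable_const (Real.exp C))
      (fun x => Real.exp_le_exp.2 (abs_le.1 (hC x)).2)
    simpa using this

lemma hcg_exp_integrable {α : Type*} [MeasurableSpace α] (ν : Measure α) [IsProbabilityMeasure ν]
    {f : α → ℝ} {C : ℝ} (hf : Measurable f) (hC : ∀ x, |f x| ≤ C) :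
    Integrable (fun x => Real.exp (f x)) ν := by
  apply Integrable.of_bound (C := Real.exp C) (by fun_prop)
  filter_upwards with x
  rw [Real.norm_eq_abs, abs_of_pos (Real.exp_pos _)]
  exact Real.exp_le_exp.2 ((le_abs_self _).trans (hC x))

lemma hcg_lin_integrable {α : Type*} [MeasurableSpace α] (ν : Measure α) [IsProbabilityMeasure ν]
    {f g : α → ℝ} {c C D : ℝ} (hf : Measurable f) (hC : ∀ x, |f x| ≤ C)
    (hg : Measurable g) (hD : ∀ x, |g x| ≤ D) :
    Integrable (fun x => Real.exp (f x) * (1 - f x + c * g x)) ν := by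
  apply Integrable.of_bound (C := Real.exp C * (1 + C + |c| * D)) (by fun_prop)
  filter_upwards with x
  exact hcg_integrand_bound (hC x) (hD x)

lemma hcgE_fst_meas : Measurable (fun z : HcgE => z.fst) := by
  exact (WithLp.prod_continuous_ofLp 2 ℝ ℝ).fst.measurable
lemma hcgE_snd_meas : Measurable (fun z : HcgE => z.snd) := by
  exact (WithLp.prod_continuous_ofLp 2 ℝ ℝ).snd.measurable

lemma hcgP_conv (c : ℝ) (μ ν : Measure HcgE) [IsProbabilityMeasure μ] [IsProbabilityMeasure ν]
    (hμ : HcgP c μ) (hν : HcgP c ν) : HcgP c (μ.conv ν) := by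
  intro H g mH mg ⟨C, hC⟩ ⟨D, hD⟩
  have mf := hcgE_fst_meas
  have ms := hcgE_snd_meas
  rw [integral_conv (hcg_lin_integrable _ (f := fun z : HcgE => H z.fst)
      (g := fun z : HcgE => g z.snd) (by fun_prop) (fun x => hC _) (by fun_prop) (fun x => hD _)),
    integral_conv (hcg_exp_integrable _ (f := fun z : HcgE => g z.snd) (by fun_prop)
      (fun x => hD _))]
  simp only [WithLp.add_fst, WithLp.add_snd]
  set A : ℝ → ℝ := fun s => ∫ y, Real.exp (H (s + y.fst)) ∂ν with hA
  set B : ℝ → ℝ := fun s => ∫ y, Real.exp (g (s + y.snd)) ∂ν with hB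
  have mA : Measurable A := by
    apply StronglyMeasurable.measurable
    apply StronglyMeasurable.integral_prod_right
    exact (by fun_prop : Measurable
      (Function.uncurry fun s (y : HcgE) => Real.exp (H (s + y.fst)))).stronglyMeasurable
  have mB : Measurable B := by
    apply StronglyMeasurable.measurable
    apply StronglyMeasurable.integral_prod_right
    exact (by fun_prop : Measurable
      (Function.uncurry fun s (y : HcgE) => Real.exp (g (s + y.snd)))).stronglyMeasurable
  have bA : ∀ s, Real.exp (-C) ≤ A s ∧ A s ≤ Real.exp C := fun s =>
    hcg_exp_int_bounds ν (f := fun y : HcgE => H (s + y.fst)) (by fun_prop) (fun x => hC _)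
  have bB : ∀ s, Real.exp (-D) ≤ B s ∧ B s ≤ Real.exp D := fun s =>
    hcg_exp_int_bounds ν (f := fun y : HcgE => g (s + y.snd)) (by fun_prop) (fun x => hD _)
  have pA : ∀ s, 0 < A s := fun s => (Real.exp_pos _).trans_le (bA s).1
  have pB : ∀ s, 0 < B s := fun s => (Real.exp_pos _).trans_le (bB s).1
  have lA : ∀ s, |Real.log (A s)| ≤ C := fun s => hcg_abs_log (bA s).1 (bA s).2
  have lB : ∀ s, |Real.log (B s)| ≤ D := fun s => hcg_abs_log (bB s).1 (bB s).2
  have key : ∀ z : HcgE, ∫ y, Real.exp (H (z.fst + y.fst)) *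
      (1 - H (z.fst + y.fst) + c * g (z.snd + y.snd)) ∂ν ≤
      Real.exp (Real.log (A z.fst)) * (1 - Real.log (A z.fst) + c * Real.log (B z.snd)) := by
    intro z
    have h := hν (fun s => H (z.fst + s) - Real.log (A z.fst))
      (fun s => g (z.snd + s) - Real.log (B z.snd)) (by fun_prop) (by fun_prop)
      ⟨C + C, fun x => (abs_sub _ _).trans (add_le_add (hC _) (lA _))⟩
      ⟨D + D, fun x => (abs_sub _ _).trans (add_le_add (hD _) (lB _))⟩
    have r1 : ∫ y : HcgE, Real.exp (g (z.snd + y.snd) - Real.log (B z.snd)) ∂ν = 1 := by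
      simp_rw [Real.exp_sub, Real.exp_log (pB _)]
      rw [integral_div]
      exact div_self (pB _).ne'
    have i1 : Integrable (fun y : HcgE => Real.exp (H (z.fst + y.fst)) *
      (1 - H (z.fst + y.fst) + c * g (z.snd + y.snd))) ν :=
      hcg_lin_integrable ν (f := fun y : HcgE => H (z.fst + y.fst))
        (g := fun y : HcgE => g (z.snd + y.snd)) (by fun_prop) (fun x => hC _) (by fun_prop)
        (fun x => hD _)
    have i2 : Integrable (fun y : HcgE => Real.exp (H (z.fst + y.fst))) ν :=
      hcg_exp_integrable ν (f := fun y : HcgE => H (z.fst + y.fst)) (by fun_prop) (fun x => hC _)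
    have r2 : ∫ y : HcgE, Real.exp (H (z.fst + y.fst) - Real.log (A z.fst)) *
        (1 - (H (z.fst + y.fst) - Real.log (A z.fst)) +
          c * (g (z.snd + y.snd) - Real.log (B z.snd))) ∂ν =
        (∫ y, Real.exp (H (z.fst + y.fst)) *
          (1 - H (z.fst + y.fst) + c * g (z.snd + y.snd)) ∂ν) / A z.fst +
        (Real.log (A z.fst) - c * Real.log (B z.snd)) := by
      have : ∀ y : HcgE, Real.exp (H (z.fst + y.fst) - Real.log (A z.fst)) *
        (1 - (H (z.fst + y.fst) - Real.log (A z.fst)) +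
          c * (g (z.snd + y.snd) - Real.log (B z.snd))) =
        (Real.exp (H (z.fst + y.fst)) *
          (1 - H (z.fst + y.fst) + c * g (z.snd + y.snd))) / A z.fst +
        Real.exp (H (z.fst + y.fst)) *
          ((Real.log (A z.fst) - c * Real.log (B z.snd)) / A z.fst) := by
        intro y
        rw [Real.exp_sub, Real.exp_log (pA _)]
        ring
      simp_rw [this]
      rw [integral_add (i1.div_const _) (i2.mul_const _), integral_div, integral_mul_const]
      congr 1
      change A z.fst * _ = _
      have := (pA z.fst).ne'
      field_simp
    rw [r1, r2, Real.one_rpow] at h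
    rw [Real.exp_log (pA _)]
    have h2 : (∫ y, Real.exp (H (z.fst + y.fst)) *
          (1 - H (z.fst + y.fst) + c * g (z.snd + y.snd)) ∂ν) / A z.fst ≤
        1 - Real.log (A z.fst) + c * Real.log (B z.snd) := by linarith
    rw [div_le_iff₀ (pA _)] at h2
    linarith
  have h := hμ (fun s => Real.log (A s)) (fun s => Real.log (B s)) (by fun_prop) (by fun_prop)
    ⟨C, lA⟩ ⟨D, lB⟩
  simp only [Real.exp_log (pB _)] at h
  refine le_trans (integral_mono ?_ ?_ key) h
  · have hi : Integrable (fun p : HcgE × HcgE => Real.exp (H (p.1.fst + p.2.fst)) *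
      (1 - H (p.1.fst + p.2.fst) + c * g (p.1.snd + p.2.snd))) (μ.prod ν) :=
      hcg_lin_integrable _ (f := fun p : HcgE × HcgE => H (p.1.fst + p.2.fst))
        (g := fun p : HcgE × HcgE => g (p.1.snd + p.2.snd)) (by fun_prop) (fun x => hC _)
        (by fun_prop) (fun x => hD _)
    exact hi.integral_prod_left
  · exact hcg_lin_integrable _ (f := fun z : HcgE => Real.log (A z.fst))
      (g := fun z : HcgE => Real.log (B z.snd)) (by fun_prop) (fun x => lA _) (by fun_prop)
      (fun x => lB _)

lemma hcgP_smul (c r : ℝ) (μ : Measure HcgE) (hμ : HcgP c μ) :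
    HcgP c (μ.map (fun z => r • z)) := by
  intro H g mH mg ⟨C, hC⟩ ⟨D, hD⟩
  have mf := hcgE_fst_meas
  have ms := hcgE_snd_meas
  rw [integral_map (by fun_prop) (by fun_prop), integral_map (by fun_prop)
    (by fun_prop : Measurable fun z : HcgE => Real.exp (g z.snd)).aestronglyMeasurable]
  simpa using hμ (fun s => H (r * s)) (fun s => g (r * s)) (by fun_prop) (by fun_prop)
    ⟨C, fun x => hC _⟩ ⟨D, fun x => hD _⟩

/-- Convolution powers. -/
noncomputable def hcgPow (μ : Measure HcgE) : ℕ → Measure HcgE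
  | 0 => Measure.dirac 0
  | n + 1 => (hcgPow μ n).conv μ

lemma hcgPow_prob (μ : Measure HcgE) [IsProbabilityMeasure μ] (n : ℕ) :
    IsProbabilityMeasure (hcgPow μ n) := by
  induction n with
  | zero => unfold hcgPow; infer_instance
  | succ n ih => unfold hcgPow; infer_instance

lemma hcgPow_charFun (μ : Measure HcgE) [IsProbabilityMeasure μ] (n : ℕ) (t : HcgE) :
    charFun (hcgPow μ n) t = charFun μ t ^ n := by
  induction n with
  | zero => simp [hcgPow]
  | succ n ih =>
    have := hcgPow_prob μ n
    rw [hcgPow, charFun_conv, ih, pow_succ]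

lemma hcgPow_P (c : ℝ) (μ : Measure HcgE) [IsProbabilityMeasure μ] (h : HcgP c μ) (n : ℕ) :
    HcgP c (hcgPow μ n) := by
  induction n with
  | zero =>
    intro H g _ _ _ _
    simp only [hcgPow, integral_dirac]
    rw [← Real.exp_mul, mul_comm _ c]
    exact hcg_exp_tangent _ _
  | succ n ih =>
    have := hcgPow_prob μ n
    exact hcgP_conv c _ _ ih h


/-- Bivariate Gaussian law with correlation `ρ`. -/
noncomputable def hcgQ (ρ : ℝ) : Measure (ℝ × ℝ) :=
  (gaussianReal 0 1).prod (gaussianReal 0 (Real.toNNReal (1 - ρ ^ 2)))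

instance hcgQ_prob (ρ : ℝ) : IsProbabilityMeasure (hcgQ ρ) := by
  unfold hcgQ; infer_instance

noncomputable def hcgG (ρ : ℝ) : Measure HcgE :=
  (hcgQ ρ).map (fun p => WithLp.toLp 2 (p.1, ρ * p.1 + p.2))

lemma hcgG_meas (ρ : ℝ) : Measurable
    (fun p : ℝ × ℝ => (WithLp.toLp 2 (p.1, ρ * p.1 + p.2) : HcgE)) := by
  fun_prop

instance hcgG_prob (ρ : ℝ) : IsProbabilityMeasure (hcgG ρ) :=
  Measure.isProbabilityMeasure_map (hcgG_meas ρ).aemeasurable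

lemma hcgG_charFun (ρ : ℝ) (hρ : ρ ∈ Set.Ioo (-1 : ℝ) 1) (t : HcgE) :
    charFun (hcgG ρ) t =
      Complex.exp (((-(t.fst ^ 2 + 2 * ρ * t.fst * t.snd + t.snd ^ 2) / 2 : ℝ)) : ℂ) := by
  have h0 : 0 ≤ 1 - ρ ^ 2 := by nlinarith [hρ.1, hρ.2]
  rw [charFun_apply, hcgG, integral_map (hcgG_meas ρ).aemeasurable (by fun_prop)]
  have : ∀ p : ℝ × ℝ, Complex.exp ((inner ℝ (WithLp.toLp 2 (p.1, ρ * p.1 + p.2) : HcgE) t : ℝ)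
      * Complex.I) =
      Complex.exp (((t.fst + ρ * t.snd : ℝ)) * p.1 * Complex.I) *
      Complex.exp ((t.snd : ℝ) * p.2 * Complex.I) := by
    intro p
    rw [← Complex.exp_add, WithLp.prod_inner_apply]
    congr 1
    simp
    ring
  simp_rw [this]
  rw [hcgQ, integral_prod_mul (fun x : ℝ => Complex.exp (((t.fst + ρ * t.snd : ℝ)) * x * Complex.I))
    (fun x : ℝ => Complex.exp ((t.snd : ℝ) * x * Complex.I)),
    ← charFun_apply_real, ← charFun_apply_real, charFun_gaussianReal, charFun_gaussianReal,
    ← Complex.exp_add]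
  congr 1
  rw [Real.coe_toNNReal _ h0]
  push_cast
  ring

lemma hcgTwo_charFun (ρ : ℝ) (hρ : ρ ∈ Set.Ioo (-1 : ℝ) 1) (t : HcgE) :
    charFun (hcgTwo ρ) t =
      (((1 + ρ) / 2 * Real.cos (t.fst + t.snd) + (1 - ρ) / 2 * Real.cos (t.fst - t.snd) : ℝ) : ℂ) := by
  rw [charFun_apply, hcgTwo_integral ρ hρ]
  simp only [WithLp.prod_inner_apply]
  simp only [Complex.real_smul]
  push_cast
  rw [Complex.cos, Complex.cos]
  simp
  ring_nf

lemma hcg_cos_lim (a : ℝ) :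
    Tendsto (fun n : ℕ => (n : ℝ) * (Real.cos ((√n)⁻¹ * a) - 1)) atTop (𝓝 (-a ^ 2 / 2)) := by
  have h0 : Tendsto (fun n : ℕ => (√(n : ℝ))⁻¹ * a) atTop (𝓝 0) := by
    rw [← zero_mul a]
    exact .mul_const a (tendsto_inv_atTop_zero.comp <| Real.tendsto_sqrt_atTop.comp <|
      tendsto_natCast_atTop_atTop)
  have h1 : Tendsto (fun n : ℕ => |a| ^ 4 * (5 / 96) * ((n : ℝ))⁻¹) atTop (𝓝 0) := by
    rw [← mul_zero (|a| ^ 4 * (5 / 96))]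
    exact tendsto_inv_atTop_zero.comp tendsto_natCast_atTop_atTop |>.const_mul _
  rw [tendsto_iff_norm_sub_tendsto_zero]
  refine squeeze_zero' (Eventually.of_forall fun n => norm_nonneg _) ?_ h1
  have h2 : ∀ᶠ n : ℕ in atTop, |(√(n : ℝ))⁻¹ * a| ≤ 1 := by
    have h0' : Tendsto (fun n : ℕ => |(√(n : ℝ))⁻¹ * a|) atTop (𝓝 0) := by
      have := h0.abs
      rwa [abs_zero] at this
    exact (h0'.eventually (gt_mem_nhds one_pos)).mono fun n hn => hn.le
  filter_upwards [h2, eventually_gt_atTop 0] with n hn hn0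
  have hn' : (0 : ℝ) < n := by exact_mod_cast hn0
  have hb := Real.cos_bound hn
  have hs : √(n : ℝ) ^ 2 = n := Real.sq_sqrt hn'.le
  have hsq : ((√(n : ℝ))⁻¹ * a) ^ 2 = a ^ 2 / n := by
    rw [mul_pow, inv_pow, hs]; field_simp
  have h4 : |(√(n : ℝ))⁻¹ * a| ^ 4 = |a| ^ 4 / n ^ 2 := by
    rw [abs_mul, mul_pow, abs_inv, inv_pow, abs_of_nonneg (Real.sqrt_nonneg _),
      show √(n : ℝ) ^ 4 = (√(n : ℝ) ^ 2) ^ 2 by ring, hs]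
    field_simp
  rw [hsq, h4] at hb
  rw [Real.norm_eq_abs]
  have e : (n : ℝ) * (Real.cos ((√n)⁻¹ * a) - 1) - -a ^ 2 / 2 =
      n * (Real.cos ((√n)⁻¹ * a) - (1 - a ^ 2 / n / 2)) := by
    field_simp
    ring
  rw [e, abs_mul, abs_of_pos hn']
  calc (n : ℝ) * |Real.cos ((√n)⁻¹ * a) - (1 - a ^ 2 / n / 2)| ≤
      n * (|a| ^ 4 / n ^ 2 * (5 / 96)) := by gcongr
    _ = _ := by field_simp

/-- Rescaled convolution powers. -/
noncomputable def hcgSeq (ρ : ℝ) (n : ℕ) : Measure HcgE :=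
  (hcgPow (hcgTwo ρ) n).map (fun z => (√(n : ℝ))⁻¹ • z)

lemma hcgSeq_prob (ρ : ℝ) (hρ : ρ ∈ Set.Ioo (-1 : ℝ) 1) (n : ℕ) :
    IsProbabilityMeasure (hcgSeq ρ n) := by
  have := hcgTwo_prob ρ hρ
  have := hcgPow_prob (hcgTwo ρ) n
  exact Measure.isProbabilityMeasure_map (by fun_prop)

lemma hcgSeq_charFun_tendsto (ρ : ℝ) (hρ : ρ ∈ Set.Ioo (-1 : ℝ) 1) (t : HcgE) :
    Tendsto (fun n => charFun (hcgSeq ρ n) t) atTop (𝓝 (charFun (hcgG ρ) t)) := by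
  have := hcgTwo_prob ρ hρ
  have e : ∀ n, charFun (hcgSeq ρ n) t = (((1 + ((1 + ρ) / 2 * (Real.cos ((√n)⁻¹ * (t.fst + t.snd)) - 1)
      + (1 - ρ) / 2 * (Real.cos ((√n)⁻¹ * (t.fst - t.snd)) - 1))) ^ n : ℝ) : ℂ) := by
    intro n
    rw [hcgSeq, charFun_map_smul, hcgPow_charFun, hcgTwo_charFun ρ hρ]
    simp only [WithLp.smul_fst, WithLp.smul_snd, smul_eq_mul]
    rw [← mul_add, ← mul_sub, ← Complex.ofReal_pow]
    congr 2
    ring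
  simp_rw [e]
  rw [hcgG_charFun ρ hρ, ← Complex.ofReal_exp]
  refine (Complex.continuous_ofReal.tendsto _).comp ?_
  apply Real.tendsto_one_add_pow_exp_of_tendsto
  have := ((hcg_cos_lim (t.fst + t.snd)).const_mul ((1 + ρ) / 2)).add
    ((hcg_cos_lim (t.fst - t.snd)).const_mul ((1 - ρ) / 2))
  convert! this using 2
  · ring
  · ring

lemma hcgG_cont (ρ : ℝ) (hρ : ρ ∈ Set.Ioo (-1 : ℝ) 1) (hρ0 : ρ ≠ 0) (H g : ℝ → ℝ)
    (hH : Continuous H) (hg : Continuous g) {C D : ℝ} (hC : ∀ x, |H x| ≤ C) (hD : ∀ x, |g x| ≤ D) :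
    ∫ z, Real.exp (H z.fst) * (1 - H z.fst + 1 / ρ ^ 2 * g z.snd) ∂(hcgG ρ) ≤
      (∫ z, Real.exp (g z.snd) ∂(hcgG ρ)) ^ (1 / ρ ^ 2) := by
  have := hcgTwo_prob ρ hρ
  have hcf : Continuous (fun z : HcgE => z.fst) := (WithLp.prod_continuous_ofLp 2 ℝ ℝ).fst
  have hcs : Continuous (fun z : HcgE => z.snd) := (WithLp.prod_continuous_ofLp 2 ℝ ℝ).snd
  let M : ℕ → ProbabilityMeasure HcgE := fun n => ⟨hcgSeq ρ n, hcgSeq_prob ρ hρ n⟩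
  let M0 : ProbabilityMeasure HcgE := ⟨hcgG ρ, hcgG_prob ρ⟩
  have hM : Tendsto M atTop (𝓝 M0) :=
    ProbabilityMeasure.tendsto_of_tendsto_charFun (hcgSeq_charFun_tendsto ρ hρ)
  rw [ProbabilityMeasure.tendsto_iff_forall_integral_tendsto] at hM
  have h1 := hM (BoundedContinuousFunction.ofNormedAddCommGroup
    (fun z : HcgE => Real.exp (H z.fst) * (1 - H z.fst + 1 / ρ ^ 2 * g z.snd)) (by fun_prop)
    (Real.exp C * (1 + C + |1 / ρ ^ 2| * D)) (fun x => hcg_integrand_bound (hC _) (hD _)))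
  have h2 := hM (BoundedContinuousFunction.ofNormedAddCommGroup
    (fun z : HcgE => Real.exp (g z.snd)) (by fun_prop) (Real.exp D) (fun x => by
      rw [Real.norm_eq_abs, abs_of_pos (Real.exp_pos _)]
      exact Real.exp_le_exp.2 ((le_abs_self _).trans (hD _))))
  simp only [BoundedContinuousFunction.coe_ofNormedAddCommGroup] at h1 h2
  refine le_of_tendsto_of_tendsto' h1 (h2.rpow_const (Or.inr (by positivity))) fun n => ?_
  exact hcgP_smul _ _ _ (hcgPow_P _ _ (hcgP_two ρ hρ hρ0) n) H g hH.measurable hg.measurable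
    ⟨C, hC⟩ ⟨D, hD⟩


lemma hcgQ_law (ρ : ℝ) (hρ : ρ ∈ Set.Ioo (-1 : ℝ) 1) :
    (hcgQ ρ).map (fun p => ρ * p.1 + p.2) = gaussianReal 0 1 := by
  have h0 : 0 ≤ 1 - ρ ^ 2 := by nlinarith [hρ.1, hρ.2]
  have h1 : (hcgQ ρ).map (fun p : ℝ × ℝ => ρ * p.1) =
      gaussianReal 0 (NNReal.mk (ρ ^ 2) (sq_nonneg _)) := by
    have : (fun p : ℝ × ℝ => ρ * p.1) = (fun x => ρ * x) ∘ Prod.fst := rfl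
    rw [this, ← Measure.map_map (by fun_prop) (by fun_prop), hcgQ, Measure.map_fst_prod]
    simp only [measure_univ, one_smul]
    rw [gaussianReal_map_const_mul]
    simp
  have h2 : (hcgQ ρ).map (fun p : ℝ × ℝ => p.2) =
      gaussianReal 0 (Real.toNNReal (1 - ρ ^ 2)) := by
    change (hcgQ ρ).map Prod.snd = _
    rw [hcgQ, Measure.map_snd_prod]
    simp
  have h3 : IndepFun (fun p : ℝ × ℝ => ρ * p.1) (fun p : ℝ × ℝ => p.2) (hcgQ ρ) :=
    indepFun_prod (X := fun x : ℝ => ρ * x) (Y := fun x : ℝ => x) (by fun_prop) (by fun_prop)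
  have := gaussianReal_add_gaussianReal_of_indepFun h3 h1 h2
  change (hcgQ ρ).map ((fun p : ℝ × ℝ => ρ * p.1) + (fun p : ℝ × ℝ => p.2)) = _
  rw [this, add_zero]
  congr 1
  ext
  rw [NNReal.coe_add, Real.coe_toNNReal _ h0]
  simp

/-- The Gaussian noise operator. -/
noncomputable def hcgK (ρ : ℝ) (g : ℝ → ℝ) (x : ℝ) : ℝ :=
  ∫ w, g (ρ * x + w) ∂(gaussianReal 0 (Real.toNNReal (1 - ρ ^ 2)))

lemma hcg_abs_integral_le {α : Type*} [MeasurableSpace α] (ν : Measure α) [IsProbabilityMeasure ν]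
    {f : α → ℝ} {C : ℝ} (hC : ∀ x, |f x| ≤ C) : |∫ x, f x ∂ν| ≤ C := by
  have := norm_integral_le_of_norm_le_const (μ := ν) (f := f) (C := C)
    (Eventually.of_forall hC)
  simpa using this

lemma hcgK_bound (ρ : ℝ) {g : ℝ → ℝ} {C : ℝ} (hC : ∀ x, |g x| ≤ C) (x : ℝ) : |hcgK ρ g x| ≤ C :=
  hcg_abs_integral_le _ (fun _ => hC _)

lemma hcg_gauss_cont (ρ : ℝ) (hρ : ρ ∈ Set.Ioo (-1 : ℝ) 1) (hρ0 : ρ ≠ 0) (g : ℝ → ℝ)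
    (hg : Continuous g) {D : ℝ} (hD : ∀ x, |g x| ≤ D) :
    ∫ x, Real.exp (1 / ρ ^ 2 * hcgK ρ g x) ∂(gaussianReal 0 1) ≤
      (∫ y, Real.exp (g y) ∂(gaussianReal 0 1)) ^ (1 / ρ ^ 2) := by
  have hcf : Continuous (fun z : HcgE => z.fst) := (WithLp.prod_continuous_ofLp 2 ℝ ℝ).fst
  have hcs : Continuous (fun z : HcgE => z.snd) := (WithLp.prod_continuous_ofLp 2 ℝ ℝ).snd
  set c := 1 / ρ ^ 2 with hc
  have hc0 : 0 ≤ c := by positivity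
  have hKc : Continuous (hcgK ρ g) := by
    unfold hcgK
    apply continuous_of_dominated (bound := fun _ => D)
    · intro x; exact (by fun_prop : Continuous fun w => g (ρ * x + w)).aestronglyMeasurable
    · intro x; exact Eventually.of_forall fun w => hD _
    · exact integrable_const _
    · exact Eventually.of_forall fun w => by fun_prop
  have hHb : ∀ x, |c * hcgK ρ g x| ≤ c * D := by
    intro x
    rw [abs_mul, abs_of_nonneg hc0]
    exact mul_le_mul_of_nonneg_left (hcgK_bound ρ hD x) hc0
  have h := hcgG_cont ρ hρ hρ0 (fun x => c * hcgK ρ g x) g (by fun_prop) hg hHb hD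
  rw [← hc] at h
  rw [hcgG, integral_map (hcgG_meas ρ).aemeasurable (by fun_prop),
    integral_map (hcgG_meas ρ).aemeasurable (by fun_prop)] at h
  simp only [WithLp.toLp_fst, WithLp.toLp_snd] at h
  have e1 : ∫ p : ℝ × ℝ, Real.exp (g (ρ * p.1 + p.2)) ∂(hcgQ ρ) =
      ∫ y, Real.exp (g y) ∂(gaussianReal 0 1) := by
    rw [← hcgQ_law ρ hρ, integral_map (by fun_prop) (by fun_prop)]
  rw [e1] at h
  refine le_trans (le_of_eq ?_) h
  have hi : Integrable (fun p : ℝ × ℝ => Real.exp (c * hcgK ρ g p.1) *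
      (1 - c * hcgK ρ g p.1 + c * g (ρ * p.1 + p.2))) (hcgQ ρ) :=
    hcg_lin_integrable _ (f := fun p : ℝ × ℝ => c * hcgK ρ g p.1)
      (g := fun p : ℝ × ℝ => g (ρ * p.1 + p.2)) (by fun_prop) (fun x => hHb _) (by fun_prop)
      (fun x => hD _)
  rw [hcgQ] at hi ⊢
  rw [integral_prod _ hi]
  apply integral_congr_ae
  filter_upwards with x
  rw [integral_const_mul]
  have hgi : Integrable (fun w => g (ρ * x + w)) (gaussianReal 0 (Real.toNNReal (1 - ρ ^ 2))) :=
    Integrable.of_bound (C := D) (by fun_prop) (Eventually.of_forall fun w => hD _)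
  rw [integral_add (integrable_const _) (hgi.const_mul c), integral_const_mul]
  simp only [integral_const, probReal_univ, one_smul]
  change _ = _ * (1 - c * hcgK ρ g x + c * hcgK ρ g x)
  ring

lemma hcg_approx (μ : Measure ℝ) [IsProbabilityMeasure μ] (g : ℝ → ℝ) (hg : Measurable g) {D : ℝ}
    (hD : ∀ x, |g x| ≤ D) : ∃ f : ℕ → ℝ → ℝ, (∀ n, Continuous (f n)) ∧ (∀ n x, |f n x| ≤ D) ∧
      ∀ᵐ x ∂μ, Tendsto (fun n => f n x) atTop (𝓝 (g x)) := by
  have hm : MemLp g 1 μ := MemLp.of_bound hg.aestronglyMeasurable D (Eventually.of_forall hD)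
  have hex : ∀ n : ℕ, ∃ f : BoundedContinuousFunction ℝ ℝ,
      eLpNorm (g - (f : ℝ → ℝ)) 1 μ ≤ ((n : ENNReal) + 1)⁻¹ := by
    intro n
    obtain ⟨f, hf, _⟩ := hm.exists_boundedContinuous_eLpNorm_sub_le (by simp)
      (ε := ((n : ENNReal) + 1)⁻¹) (by simp)
    exact ⟨f, hf⟩
  choose f hf using hex
  have ht : Tendsto (fun n => eLpNorm ((f n : ℝ → ℝ) - g) 1 μ) atTop (𝓝 0) := by
    have h0 : Tendsto (fun n : ℕ => ((n : ENNReal) + 1)⁻¹) atTop (𝓝 0) := by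
      have := (ENNReal.tendsto_inv_nat_nhds_zero).comp (tendsto_add_atTop_nat 1)
      simpa [Function.comp_def] using this
    refine tendsto_of_tendsto_of_tendsto_of_le_of_le tendsto_const_nhds h0 (fun n => zero_le) ?_
    intro n
    change eLpNorm ((f n : ℝ → ℝ) - g) 1 μ ≤ _
    rw [eLpNorm_sub_comm]
    exact hf n
  obtain ⟨ns, _, hns⟩ := (tendstoInMeasure_of_tendsto_eLpNorm one_ne_zero
    (fun n => (f n).continuous.aestronglyMeasurable) hg.aestronglyMeasurable ht).exists_seq_tendsto_ae
  have hD0 : 0 ≤ D := (abs_nonneg _).trans (hD 0)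
  refine ⟨fun n x => max (-D) (min D (f (ns n) x)), fun n => ?_, fun n x => ?_, ?_⟩
  · have := (f (ns n)).continuous
    fun_prop
  · rw [abs_le]
    exact ⟨le_max_left _ _, max_le (by linarith) (min_le_left _ _)⟩
  · filter_upwards [hns] with x hx
    have h2 : g x = max (-D) (min D (g x)) := by
      have := abs_le.1 (hD x)
      rw [min_eq_right this.2, max_eq_right this.1]
    rw [h2]
    exact tendsto_const_nhds.max (tendsto_const_nhds.min hx)

lemma hcg_gauss (ρ : ℝ) (hρ : ρ ∈ Set.Ioo (-1 : ℝ) 1) (hρ0 : ρ ≠ 0) (g : ℝ → ℝ)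
    (hg : Measurable g) {D : ℝ} (hD : ∀ x, |g x| ≤ D) :
    ∫ x, Real.exp (1 / ρ ^ 2 * hcgK ρ g x) ∂(gaussianReal 0 1) ≤
      (∫ y, Real.exp (g y) ∂(gaussianReal 0 1)) ^ (1 / ρ ^ 2) := by
  obtain ⟨f, fc, fb, fl⟩ := hcg_approx (gaussianReal 0 1) g hg hD
  have mK : ∀ k : ℝ → ℝ, Measurable k → Measurable (hcgK ρ k) := by
    intro k hk
    apply StronglyMeasurable.measurable
    apply StronglyMeasurable.integral_prod_right
    exact (by fun_prop : Measurable
      (Function.uncurry fun x w => k (ρ * x + w))).stronglyMeasurable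
  have hR : Tendsto (fun n => ∫ y, Real.exp (f n y) ∂(gaussianReal 0 1)) atTop
      (𝓝 (∫ y, Real.exp (g y) ∂(gaussianReal 0 1))) := by
    apply tendsto_integral_of_dominated_convergence (fun _ => Real.exp D)
    · intro n; have := fc n; fun_prop
    · exact integrable_const _
    · intro n
      filter_upwards with x
      rw [Real.norm_eq_abs, abs_of_pos (Real.exp_pos _)]
      exact Real.exp_le_exp.2 ((le_abs_self _).trans (fb n x))
    · filter_upwards [fl] with x hx
      exact (Real.continuous_exp.tendsto _).comp hx
  have hae : ∀ᵐ x ∂(gaussianReal 0 1), ∀ᵐ w ∂(gaussianReal 0 (Real.toNNReal (1 - ρ ^ 2))),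
      Tendsto (fun n => f n (ρ * x + w)) atTop (𝓝 (g (ρ * x + w))) := by
    rw [← hcgQ_law ρ hρ] at fl
    have := ae_of_ae_map (by fun_prop) fl
    exact Measure.ae_ae_of_ae_prod this
  have hL : Tendsto (fun n => ∫ x, Real.exp (1 / ρ ^ 2 * hcgK ρ (f n) x) ∂(gaussianReal 0 1)) atTop
      (𝓝 (∫ x, Real.exp (1 / ρ ^ 2 * hcgK ρ g x) ∂(gaussianReal 0 1))) := by
    apply tendsto_integral_of_dominated_convergence (fun _ => Real.exp (1 / ρ ^ 2 * D))
    · intro n; have := mK _ (fc n).measurable; fun_prop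
    · exact integrable_const _
    · intro n
      filter_upwards with x
      rw [Real.norm_eq_abs, abs_of_pos (Real.exp_pos _)]
      apply Real.exp_le_exp.2
      exact mul_le_mul_of_nonneg_left ((le_abs_self _).trans (hcgK_bound ρ (fb n) x))
        (by positivity)
    · filter_upwards [hae] with x hx
      refine (Real.continuous_exp.tendsto _).comp (Tendsto.const_mul _ ?_)
      apply tendsto_integral_of_dominated_convergence (fun _ => D)
      · intro n; have := fc n; fun_prop
      · exact integrable_const _
      · intro n; exact Eventually.of_forall fun w => fb n _
      · exact hx
  exact le_of_tendsto_of_tendsto' hL (hR.rpow_const (Or.inr (by positivity)))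
    (fun n => hcg_gauss_cont ρ hρ hρ0 (f n) (fc n) (fb n))


lemma hcg_dv {α : Type*} [MeasurableSpace α] (μ ν : Measure α) [IsProbabilityMeasure μ]
    [IsProbabilityMeasure ν] (hac : μ ≪ ν) (hi : Integrable (llr μ ν) μ) (h : α → ℝ)
    (h1 : Integrable h μ) (h2 : Integrable (fun x => Real.exp (h x)) ν)
    (h3 : ∫ x, Real.exp (h x) ∂ν ≤ 1) : ∫ x, h x ∂μ ≤ ∫ x, llr μ ν x ∂μ := by
  have e1 : ∫ x, h x ∂μ = ∫ x, (μ.rnDeriv ν x).toReal * h x ∂ν := by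
    rw [← integral_rnDeriv_smul hac]; rfl
  have i1 : Integrable (fun x => (μ.rnDeriv ν x).toReal * h x) ν :=
    (integrable_rnDeriv_smul_iff hac).2 h1
  have e2 : ∫ x, llr μ ν x ∂μ = ∫ x, (μ.rnDeriv ν x).toReal * llr μ ν x ∂ν := by
    rw [← integral_rnDeriv_smul hac]; rfl
  have i2 : Integrable (fun x => (μ.rnDeriv ν x).toReal * llr μ ν x) ν :=
    (integrable_rnDeriv_smul_iff hac).2 hi
  have i3 : Integrable (fun x => (μ.rnDeriv ν x).toReal) ν := Measure.integrable_toReal_rnDeriv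
  have e3 : ∫ x, (μ.rnDeriv ν x).toReal ∂ν = 1 := by
    rw [Measure.integral_toReal_rnDeriv hac]; simp
  have key : ∀ x, (μ.rnDeriv ν x).toReal * h x ≤
      ((μ.rnDeriv ν x).toReal * llr μ ν x + Real.exp (h x)) - (μ.rnDeriv ν x).toReal := by
    intro x
    rcases (ENNReal.toReal_nonneg (a := μ.rnDeriv ν x)).eq_or_lt with h0 | h0
    · rw [← h0]; simp; positivity
    · have := hcg_exp_tangent (llr μ ν x) (h x)
      rw [llr, Real.exp_log h0] at this
      rw [llr]
      linarith
  have i4 : Integrable (fun x => (μ.rnDeriv ν x).toReal * llr μ ν x + Real.exp (h x)) ν :=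
    i2.add h2
  have i5 : Integrable (fun x => (μ.rnDeriv ν x).toReal * llr μ ν x + Real.exp (h x) -
    (μ.rnDeriv ν x).toReal) ν := i4.sub i3
  have := integral_mono i1 i5 key
  rw [integral_sub i4 i3, integral_add i2 h2, e3] at this
  linarith

/-- Lemma: kernel form of the Markov property. -/
lemma hcg_markov {Ω A : Type*} [MeasurableSpace Ω] [StandardBorelSpace Ω] [MeasurableSpace A]
    (P : Measure Ω) [IsProbabilityMeasure P] (U : Ω → A) (X Y : Ω → ℝ)
    (mU : Measurable U) (mX : Measurable X) (mY : Measurable Y) (ρ : ℝ)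
    (hlaw : P.map (fun ω => (X ω, Y ω)) = (hcgQ ρ).map (fun p => (p.1, ρ * p.1 + p.2)))
    (hmk : CondIndepFun (MeasurableSpace.comap X inferInstance) mX.comap_le U Y P) :
    P.map (fun ω => (U ω, Y ω)) = ((P.map (fun ω => (U ω, X ω))).prod
      (gaussianReal 0 (Real.toNNReal (1 - ρ ^ 2)))).map (fun q => (q.1.1, ρ * q.1.2 + q.2)) := by
  set η := gaussianReal 0 (Real.toNNReal (1 - ρ ^ 2)) with hη
  have hPX : P.map X = gaussianReal 0 1 := by
    have h1 : P.map X = (P.map (fun ω => (X ω, Y ω))).map Prod.fst := by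
      rw [Measure.map_map measurable_fst (by fun_prop)]; rfl
    rw [h1, hlaw, Measure.map_map measurable_fst (by fun_prop)]
    change (hcgQ ρ).map Prod.fst = _
    rw [hcgQ, Measure.map_fst_prod]; simp
  have : IsProbabilityMeasure (P.map (fun ω => (U ω, X ω))) :=
    Measure.isProbabilityMeasure_map (by fun_prop)
  have : IsProbabilityMeasure (P.map (fun ω => (U ω, Y ω))) :=
    Measure.isProbabilityMeasure_map (by fun_prop)
  have mmap : Measurable (fun q : (A × ℝ) × ℝ => (q.1.1, ρ * q.1.2 + q.2)) := by fun_prop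
  have : IsProbabilityMeasure (((P.map (fun ω => (U ω, X ω))).prod η).map
      (fun q => (q.1.1, ρ * q.1.2 + q.2))) := Measure.isProbabilityMeasure_map (by fun_prop)
  refine Measure.ext_prod fun {s t} hs ht => ?_
  set k : ℝ → ENNReal := fun x => η {w | ρ * x + w ∈ t} with hk
  have mset : MeasurableSet {p : ℝ × ℝ | ρ * p.1 + p.2 ∈ t} :=
    (by fun_prop : Measurable fun p : ℝ × ℝ => ρ * p.1 + p.2) ht
  have mk : Measurable k := measurable_measure_prodMk_left mset
  have k1 : ∀ x, k x ≤ 1 := fun x => prob_le_one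
  have kr : ∀ x, (k x).toReal ≤ 1 := fun x => by
    have := ENNReal.toReal_mono ENNReal.one_ne_top (k1 x); simpa using this
  have kn : ∀ x, 0 ≤ (k x).toReal := fun x => ENNReal.toReal_nonneg
  have hm := mX.comap_le
  -- conditional probability of Y
  have hcY : (fun ω => (k (X ω)).toReal) =ᵐ[P]
      P[(Y ⁻¹' t).indicator (fun _ => (1 : ℝ)) | MeasurableSpace.comap X inferInstance] := by
    apply ae_eq_condExp_of_forall_setIntegral_eq hm
    · exact (integrable_const (1 : ℝ)).indicator (mY ht)
    · intro S _ _
      refine Integrable.integrableOn (Integrable.of_bound (C := 1)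
        (mk.ennreal_toReal.comp mX).aestronglyMeasurable ?_)
      filter_upwards with ω
      rw [Real.norm_eq_abs, abs_of_nonneg (kn _)]; exact kr _
    · rintro S ⟨B, hB, rfl⟩ _
      rw [setIntegral_indicator (mY ht)]
      simp only [integral_const, smul_eq_mul, mul_one, measureReal_restrict_apply_univ]
      rw [integral_toReal (by fun_prop) (Eventually.of_forall fun ω => (k1 _).trans_lt (by simp)),
        Measure.real]
      congr 1
      have e1 : P (X ⁻¹' B ∩ Y ⁻¹' t) = (hcgQ ρ) {p | p.1 ∈ B ∧ ρ * p.1 + p.2 ∈ t} := by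
        have : P (X ⁻¹' B ∩ Y ⁻¹' t) = P.map (fun ω => (X ω, Y ω)) (B ×ˢ t) := by
          rw [Measure.map_apply (by fun_prop) (hB.prod ht)]; rfl
        rw [this, hlaw, Measure.map_apply (by fun_prop) (hB.prod ht)]; rfl
      have mset2 : MeasurableSet {p : ℝ × ℝ | p.1 ∈ B ∧ ρ * p.1 + p.2 ∈ t} :=
        (measurable_fst hB).inter mset
      rw [e1, hcgQ, Measure.prod_apply mset2, ← hPX]
      rw [lintegral_map (measurable_measure_prodMk_left mset2) mX, ← lintegral_indicator (mX hB)]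
      apply lintegral_congr
      intro ω
      by_cases hω : X ω ∈ B
      · rw [Set.indicator_of_mem (by exact hω)]
        simp only [hk]
        congr 1
        ext w
        simp [hω]
      · rw [Set.indicator_of_notMem (by exact hω)]
        symm
        convert! measure_empty (μ := η)
        ext w
        simp [hω]
    · refine StronglyMeasurable.aestronglyMeasurable (Measurable.stronglyMeasurable ?_)
      exact (mk.ennreal_toReal).comp (comap_measurable X)
  have hci := (condIndepFun_iff_condExp_inter_preimage_eq_mul mU mY).1 hmk s t hs ht
  have hiU : Integrable ((U ⁻¹' s).indicator (fun _ => (1 : ℝ))) P :=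
    (integrable_const (1 : ℝ)).indicator (mU hs)
  have hkm : StronglyMeasurable[MeasurableSpace.comap X inferInstance]
      (fun ω => (k (X ω)).toReal) :=
    Measurable.stronglyMeasurable ((mk.ennreal_toReal).comp (comap_measurable X))
  have hpull := condExp_stronglyMeasurable_mul_of_bound hm hkm hiU 1
    (Eventually.of_forall fun ω => by
      rw [Real.norm_eq_abs, abs_of_nonneg (kn _)]; exact kr _)
  have hreal : P.real (U ⁻¹' s ∩ Y ⁻¹' t) =
      ∫ ω, (k (X ω)).toReal * (U ⁻¹' s).indicator (fun _ => (1 : ℝ)) ω ∂P := by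
    have e1 : P.real (U ⁻¹' s ∩ Y ⁻¹' t) =
        ∫ ω, (U ⁻¹' s ∩ Y ⁻¹' t).indicator (fun _ => (1 : ℝ)) ω ∂P := by
      rw [integral_indicator ((mU hs).inter (mY ht))]; simp
    rw [e1, ← integral_condExp hm, integral_congr_ae hci]
    rw [← integral_condExp hm (f := fun ω => (k (X ω)).toReal *
      (U ⁻¹' s).indicator (fun _ => (1 : ℝ)) ω)]
    apply integral_congr_ae
    filter_upwards [hpull, hcY] with ω h1 h2
    have h1' := h1
    simp only [Pi.mul_apply] at h1'
    refine Eq.trans ?_ h1'.symm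
    rw [h2, mul_comm]
  have l1 : P.map (fun ω => (U ω, Y ω)) (s ×ˢ t) = P (U ⁻¹' s ∩ Y ⁻¹' t) := by
    rw [Measure.map_apply (by fun_prop) (hs.prod ht)]; rfl
  have l2 : ((P.map (fun ω => (U ω, X ω))).prod η).map
      (fun q => (q.1.1, ρ * q.1.2 + q.2)) (s ×ˢ t) =
      ∫⁻ ω, k (X ω) * (U ⁻¹' s).indicator (fun _ => 1) ω ∂P := by
    have mpre := mmap (hs.prod ht)
    rw [Measure.map_apply mmap (hs.prod ht), Measure.prod_apply mpre,
      lintegral_map (measurable_measure_prodMk_left mpre) (by fun_prop)]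
    apply lintegral_congr
    intro ω
    by_cases hω : U ω ∈ s
    · rw [Set.indicator_of_mem (by exact hω), mul_one]
      simp only [hk]
      congr 1
      ext w
      simp [hω]
    · rw [Set.indicator_of_notMem (by exact hω), mul_zero]
      convert! measure_empty (μ := η)
      ext w
      simp [hω]
  rw [l1, l2]
  rw [← ENNReal.ofReal_toReal (measure_ne_top P (U ⁻¹' s ∩ Y ⁻¹' t))]
  change ENNReal.ofReal (P.real _) = _
  rw [hreal, ofReal_integral_eq_lintegral_ofReal]
  · apply lintegral_congr
    intro ω
    rw [ENNReal.ofReal_mul (kn _), ENNReal.ofReal_toReal ((k1 _).trans_lt (by simp)).ne]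
    congr 1
    by_cases hω : ω ∈ U ⁻¹' s <;> simp [hω]
  · refine Integrable.of_bound (C := 1) ((mk.ennreal_toReal.comp mX).mul
      (measurable_const.indicator (mU hs))).aestronglyMeasurable ?_
    filter_upwards with ω
    rw [norm_mul, Real.norm_eq_abs, abs_of_nonneg (kn _)]
    have h5 : ‖(U ⁻¹' s).indicator (fun _ => (1 : ℝ)) ω‖ ≤ 1 := by
      by_cases hω : ω ∈ U ⁻¹' s <;> simp [hω]
    exact mul_le_one₀ (kr _) (norm_nonneg _) h5
  · filter_upwards with ω
    exact mul_nonneg (kn _) (Set.indicator_nonneg (by simp) _)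


lemma hcg_upper_bdd {Ω A : Type*} [MeasurableSpace Ω] [StandardBorelSpace Ω] [MeasurableSpace A]
    (P : Measure Ω) [IsProbabilityMeasure P] (U : Ω → A) (X Y : Ω → ℝ)
    (mU : Measurable U) (mX : Measurable X) (mY : Measurable Y) (ρ : ℝ)
    (hρ : ρ ∈ Set.Ioo (-1 : ℝ) 1) (hρ0 : ρ ≠ 0)
    (hlaw : P.map (fun ω => (X ω, Y ω)) = (hcgQ ρ).map (fun p => (p.1, ρ * p.1 + p.2)))
    (hmk : CondIndepFun (MeasurableSpace.comap X inferInstance) mX.comap_le U Y P)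
    (hPX : P.map X = gaussianReal 0 1)
    (hac : P.map (fun ω => (U ω, X ω)) ≪ (P.map U).prod (P.map X))
    (hi : Integrable (llr (P.map (fun ω => (U ω, X ω))) ((P.map U).prod (P.map X)))
      (P.map (fun ω => (U ω, X ω))))
    (g : A × ℝ → ℝ) (mg : Measurable g) {D : ℝ} (hD : ∀ z, |g z| ≤ D) :
    ∫ z, g z ∂(P.map (fun ω => (U ω, Y ω))) ≤
      ρ ^ 2 * ∫ z, llr (P.map (fun ω => (U ω, X ω))) ((P.map U).prod (P.map X)) z
        ∂(P.map (fun ω => (U ω, X ω))) +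
      (∫ z, Real.exp (g z) ∂((P.map U).prod (gaussianReal 0 1)) - 1) := by
  set μX := P.map (fun ω => (U ω, X ω)) with hμX
  have iX : IsProbabilityMeasure μX := Measure.isProbabilityMeasure_map (by fun_prop)
  have iU : IsProbabilityMeasure (P.map U) := Measure.isProbabilityMeasure_map (by fun_prop)
  have iPX : IsProbabilityMeasure (P.map X) := Measure.isProbabilityMeasure_map (by fun_prop)
  set I := ∫ z, llr μX ((P.map U).prod (P.map X)) z ∂μX with hI
  set η := gaussianReal 0 (Real.toNNReal (1 - ρ ^ 2)) with hη
  set c := 1 / ρ ^ 2 with hc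
  have hρ2 : 0 < ρ ^ 2 := by positivity
  have hc0 : 0 ≤ c := by positivity
  have hcρ : ρ ^ 2 * c = 1 := by rw [hc]; field_simp
  set K : A × ℝ → ℝ := fun z => hcgK ρ (fun y => g (z.1, y)) z.2 with hK
  set B : A → ℝ := fun u => ∫ y, Real.exp (g (u, y)) ∂(gaussianReal 0 1) with hB
  have mK : Measurable K := by
    apply StronglyMeasurable.measurable
    apply StronglyMeasurable.integral_prod_right (f := fun (z : A × ℝ) (w : ℝ) =>
      g (z.1, ρ * z.2 + w))
    exact (by fun_prop : Measurable
      (Function.uncurry fun (z : A × ℝ) (w : ℝ) => g (z.1, ρ * z.2 + w))).stronglyMeasurable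
  have mB : Measurable B := by
    apply StronglyMeasurable.measurable
    apply StronglyMeasurable.integral_prod_right (f := fun (u : A) (y : ℝ) =>
      Real.exp (g (u, y)))
    exact (by fun_prop : Measurable
      (Function.uncurry fun (u : A) (y : ℝ) => Real.exp (g (u, y)))).stronglyMeasurable
  have bK : ∀ z, |K z| ≤ D := fun z => hcgK_bound ρ (fun _ => hD _) _
  have mgu : ∀ u, Measurable fun y => g (u, y) := fun u => by fun_prop
  have bB : ∀ u, Real.exp (-D) ≤ B u ∧ B u ≤ Real.exp D := fun u =>
    hcg_exp_int_bounds (gaussianReal 0 1) (mgu u) (fun _ => hD _)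
  have B0 : ∀ u, 0 < B u := fun u => (Real.exp_pos _).trans_le (bB u).1
  have blog : ∀ u, |Real.log (B u)| ≤ D := fun u => by
    rw [abs_le]
    constructor
    · rw [Real.le_log_iff_exp_le (B0 u)]; exact (bB u).1
    · rw [Real.log_le_iff_le_exp (B0 u)]; exact (bB u).2
  have iK : Integrable K μX := Integrable.of_bound (C := D) mK.aestronglyMeasurable
    (Eventually.of_forall bK)
  have ilog : Integrable (fun u => Real.log (B u)) (P.map U) :=
    Integrable.of_bound (C := D) (mB.log).aestronglyMeasurable (Eventually.of_forall blog)
  have ilog' : Integrable (fun z : A × ℝ => Real.log (B z.1)) μX :=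
    Integrable.of_bound (C := D) ((mB.log).comp measurable_fst).aestronglyMeasurable
      (Eventually.of_forall fun z => blog _)
  have iBB : Integrable B (P.map U) :=
    Integrable.of_bound (C := Real.exp D) mB.aestronglyMeasurable
      (Eventually.of_forall fun u => by
        rw [Real.norm_eq_abs, abs_of_pos (B0 u)]; exact (bB u).2)
  have ieg : Integrable (fun z => Real.exp (g z)) ((P.map U).prod (gaussianReal 0 1)) :=
    hcg_exp_integrable _ mg hD
  have eB : ∫ z, Real.exp (g z) ∂((P.map U).prod (gaussianReal 0 1)) = ∫ u, B u ∂(P.map U) :=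
    integral_prod _ ieg
  have elog : ∫ z : A × ℝ, Real.log (B z.1) ∂μX = ∫ u, Real.log (B u) ∂(P.map U) := by
    have : P.map U = μX.map Prod.fst := by
      rw [hμX, Measure.map_map measurable_fst (by fun_prop)]; rfl
    rw [this, integral_map (by fun_prop) (mB.log).aestronglyMeasurable]
  have eg : ∫ z, g z ∂(P.map (fun ω => (U ω, Y ω))) = ∫ z, K z ∂μX := by
    rw [hcg_markov P U X Y mU mX mY ρ hlaw hmk, integral_map (by fun_prop) mg.aestronglyMeasurable]
    rw [integral_prod]
    · rfl
    · refine Integrable.of_bound (C := D) ?_ (Eventually.of_forall fun z => hD _)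
      exact (by fun_prop : Measurable fun q : (A × ℝ) × ℝ =>
        g (q.1.1, ρ * q.1.2 + q.2)).aestronglyMeasurable
  -- the test function
  set h : A × ℝ → ℝ := fun z => c * (K z - Real.log (B z.1)) with hh
  have mh : Measurable h := by fun_prop
  have bh : ∀ z, |h z| ≤ c * (D + D) := fun z => by
    rw [hh, abs_mul, abs_of_nonneg hc0]
    refine mul_le_mul_of_nonneg_left ((abs_sub _ _).trans (add_le_add (bK z) (blog _))) hc0
  have ih : Integrable h μX := (iK.sub ilog').const_mul c
  have ihe : Integrable (fun z => Real.exp (h z)) ((P.map U).prod (P.map X)) :=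
    hcg_exp_integrable _ mh bh
  have h1 : ∫ z, Real.exp (h z) ∂((P.map U).prod (P.map X)) ≤ 1 := by
    rw [integral_prod _ ihe]
    have : ∀ u, ∫ x, Real.exp (h (u, x)) ∂(P.map X) ≤ 1 := by
      intro u
      rw [hPX]
      have e : ∀ x, Real.exp (h (u, x)) =
          (B u ^ c)⁻¹ * Real.exp (c * hcgK ρ (fun y => g (u, y)) x) := by
        intro x
        rw [Real.rpow_def_of_pos (B0 u), ← Real.exp_neg, ← Real.exp_add]
        congr 1
        simp only [hh, hK]
        ring
      simp_rw [e]
      rw [integral_const_mul]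
      have := hcg_gauss ρ hρ hρ0 (fun y => g (u, y)) (mgu u) (fun _ => hD _)
      rw [← hc] at this
      have hp : 0 < B u ^ c := Real.rpow_pos_of_pos (B0 u) _
      rw [inv_mul_le_iff₀ hp, mul_one]
      exact this
    calc _ ≤ ∫ _u, (1 : ℝ) ∂(P.map U) :=
          integral_mono ihe.integral_prod_left (integrable_const _) this
      _ = 1 := by simp
  have hdv := hcg_dv μX _ hac hi h ih ihe h1
  rw [hh, integral_const_mul, integral_sub iK ilog', elog] at hdv
  have hlogB : ∫ u, Real.log (B u) ∂(P.map U) ≤ ∫ u, B u ∂(P.map U) - 1 := by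
    have : ∫ u, Real.log (B u) ∂(P.map U) ≤ ∫ u, (B u - 1) ∂(P.map U) :=
      integral_mono ilog (iBB.sub (integrable_const _))
        (fun u => Real.log_le_sub_one_of_pos (B0 u))
    rw [integral_sub iBB (integrable_const _)] at this
    simpa using this
  rw [eg, eB]
  have := mul_le_mul_of_nonneg_left hdv hρ2.le
  rw [← mul_assoc, hcρ, one_mul] at this
  linarith

lemma hcg_upper {Ω A : Type*} [MeasurableSpace Ω] [StandardBorelSpace Ω] [MeasurableSpace A]
    (P : Measure Ω) [IsProbabilityMeasure P] (U : Ω → A) (X Y : Ω → ℝ)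
    (mU : Measurable U) (mX : Measurable X) (mY : Measurable Y) (ρ : ℝ)
    (hρ : ρ ∈ Set.Ioo (-1 : ℝ) 1) (hρ0 : ρ ≠ 0)
    (hlaw : P.map (fun ω => (X ω, Y ω)) = (hcgQ ρ).map (fun p => (p.1, ρ * p.1 + p.2)))
    (hmk : CondIndepFun (MeasurableSpace.comap X inferInstance) mX.comap_le U Y P)
    (hPX : P.map X = gaussianReal 0 1) (hPY : P.map Y = gaussianReal 0 1)
    (hac : P.map (fun ω => (U ω, X ω)) ≪ (P.map U).prod (P.map X))
    (hi : Integrable (llr (P.map (fun ω => (U ω, X ω))) ((P.map U).prod (P.map X)))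
      (P.map (fun ω => (U ω, X ω))))
    (hacY : P.map (fun ω => (U ω, Y ω)) ≪ (P.map U).prod (P.map Y))
    (hiY : Integrable (llr (P.map (fun ω => (U ω, Y ω))) ((P.map U).prod (P.map Y)))
      (P.map (fun ω => (U ω, Y ω)))) :
    ∫ z, llr (P.map (fun ω => (U ω, Y ω))) ((P.map U).prod (P.map Y)) z
        ∂(P.map (fun ω => (U ω, Y ω))) ≤
      ρ ^ 2 * ∫ z, llr (P.map (fun ω => (U ω, X ω))) ((P.map U).prod (P.map X)) z
        ∂(P.map (fun ω => (U ω, X ω))) := by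
  have key := hcg_upper_bdd P U X Y mU mX mY ρ hρ hρ0 hlaw hmk hPX hac hi
  rw [← hPY] at key
  set μ := P.map (fun ω => (U ω, Y ω)) with hμ
  have iY : IsProbabilityMeasure μ := Measure.isProbabilityMeasure_map (by fun_prop)
  have iU : IsProbabilityMeasure (P.map U) := Measure.isProbabilityMeasure_map (by fun_prop)
  have iPY : IsProbabilityMeasure (P.map Y) := Measure.isProbabilityMeasure_map (by fun_prop)
  set ν := (P.map U).prod (P.map Y) with hν
  set I := ∫ z, llr (P.map (fun ω => (U ω, X ω))) ((P.map U).prod (P.map X)) z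
        ∂(P.map (fun ω => (U ω, X ω))) with hI
  set p : A × ℝ → ℝ := fun z => (μ.rnDeriv ν z).toReal with hp
  have mp : Measurable p := (Measure.measurable_rnDeriv μ ν).ennreal_toReal
  have p0 : ∀ z, 0 ≤ p z := fun z => ENNReal.toReal_nonneg
  set q : ℕ → A × ℝ → ℝ := fun n z => max (Real.exp (-n)) (min (Real.exp n) (p z)) with hq
  have q0 : ∀ n z, 0 < q n z := fun n z => lt_max_of_lt_left (Real.exp_pos _)
  have mq : ∀ n, Measurable (q n) := fun n => by fun_prop
  have een : ∀ n : ℕ, Real.exp (-(n : ℝ)) ≤ 1 := fun n => by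
    rw [Real.exp_le_one_iff]; simp
  have een' : ∀ n : ℕ, 1 ≤ Real.exp (n : ℝ) := fun n => by
    rw [Real.one_le_exp_iff]; simp
  have bq : ∀ n z, |Real.log (q n z)| ≤ n := fun n z => by
    rw [abs_le]
    constructor
    · rw [Real.le_log_iff_exp_le (q0 n z)]; exact le_max_left _ _
    · rw [Real.log_le_iff_le_exp (q0 n z)]
      exact max_le ((een n).trans (een' n)) (min_le_left _ _)
  have hn : ∀ n, ∫ z, Real.log (q n z) ∂μ ≤ ρ ^ 2 * I + (∫ z, q n z ∂ν - 1) := by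
    intro n
    have := key (fun z => Real.log (q n z)) (by fun_prop) (bq n)
    simp_rw [Real.exp_log (q0 n _)] at this
    exact this
  have ip : Integrable p ν := Measure.integrable_toReal_rnDeriv
  have ep : ∫ z, p z ∂ν = 1 := by
    rw [hp, Measure.integral_toReal_rnDeriv hacY]; simp
  -- pointwise limits
  have limq : ∀ z, Tendsto (fun n => q n z) atTop (𝓝 (p z)) := by
    intro z
    have l1 : Tendsto (fun n : ℕ => Real.exp (-(n : ℝ))) atTop (𝓝 0) :=
      Real.tendsto_exp_neg_atTop_nhds_zero.comp tendsto_natCast_atTop_atTop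
    have l2 : Tendsto (fun n : ℕ => min (Real.exp (n : ℝ)) (p z)) atTop (𝓝 (p z)) := by
      apply tendsto_const_nhds.congr'
      have := (Real.tendsto_exp_atTop.comp (tendsto_natCast_atTop_atTop (R := ℝ))).eventually_ge_atTop (p z)
      filter_upwards [this] with n hn'
      exact (min_eq_right hn').symm
    have := l1.max l2
    rwa [max_eq_right (p0 z)] at this
  have L2 : Tendsto (fun n => ∫ z, q n z ∂ν) atTop (𝓝 (∫ z, p z ∂ν)) := by
    apply tendsto_integral_of_dominated_convergence (fun z => p z + 1)
    · intro n; exact (mq n).aestronglyMeasurable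
    · exact ip.add (integrable_const _)
    · intro n
      filter_upwards with z
      rw [Real.norm_eq_abs, abs_of_pos (q0 n z)]
      refine max_le ?_ ((min_le_right _ _).trans (by linarith))
      linarith [een n, p0 z]
    · filter_upwards with z using limq z
  have ppos : ∀ᵐ z ∂μ, 0 < p z := by
    filter_upwards [Measure.rnDeriv_pos hacY, hacY.ae_le (Measure.rnDeriv_lt_top μ ν)] with z h1 h2
    exact ENNReal.toReal_pos h1.ne' h2.ne
  have L1 : Tendsto (fun n => ∫ z, Real.log (q n z) ∂μ) atTop (𝓝 (∫ z, llr μ ν z ∂μ)) := by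
    apply tendsto_integral_of_dominated_convergence (fun z => |llr μ ν z|)
    · intro n; exact (mq n).log.aestronglyMeasurable
    · exact hiY.abs
    · intro n
      filter_upwards [ppos] with z hz
      change |Real.log (q n z)| ≤ |Real.log (p z)|
      rcases le_total 1 (p z) with h | h
      · have e : q n z = min (Real.exp n) (p z) :=
          max_eq_right ((een n).trans (le_min (een' n) h))
        have h1 : 1 ≤ q n z := by rw [e]; exact le_min (een' n) h
        rw [abs_of_nonneg (Real.log_nonneg h1), abs_of_nonneg (Real.log_nonneg h)]
        exact Real.log_le_log (q0 n z) (by rw [e]; exact min_le_right _ _)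
      · have e : q n z = max (Real.exp (-n)) (p z) := by
          simp only [hq]; rw [min_eq_right (h.trans (een' n))]
        have h1 : q n z ≤ 1 := by rw [e]; exact max_le (een n) h
        rw [abs_of_nonpos (Real.log_nonpos (q0 n z).le h1), abs_of_nonpos (Real.log_nonpos hz.le h)]
        exact neg_le_neg (Real.log_le_log hz (by rw [e]; exact le_max_right _ _))
    · filter_upwards [ppos] with z hz
      exact (limq z).log hz.ne'
  have := le_of_tendsto_of_tendsto' L1 (tendsto_const_nhds.add (L2.sub tendsto_const_nhds)) hn
  rw [ep] at this
  simpa using this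


lemma hcg_finite {Ω : Type*} [MeasurableSpace Ω] (P : Measure Ω) [IsProbabilityMeasure P]
    (U : Ω → Bool) (Z : Ω → ℝ) (mU : Measurable U) (mZ : Measurable Z)
    (hpos : ∀ b, 0 < (P.map U).real {b}) :
    P.map (fun ω => (U ω, Z ω)) ≪ (P.map U).prod (P.map Z) ∧
    Integrable (llr (P.map (fun ω => (U ω, Z ω))) ((P.map U).prod (P.map Z)))
      (P.map (fun ω => (U ω, Z ω))) ∧
    ∫ z, llr (P.map (fun ω => (U ω, Z ω))) ((P.map U).prod (P.map Z)) z
      ∂(P.map (fun ω => (U ω, Z ω))) ≤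
      (P.map U).real {true} * (-Real.log ((P.map U).real {true})) +
      (P.map U).real {false} * (-Real.log ((P.map U).real {false})) := by
  have iμ : IsProbabilityMeasure (P.map (fun ω => (U ω, Z ω))) :=
    Measure.isProbabilityMeasure_map (by fun_prop)
  have iU : IsProbabilityMeasure (P.map U) := Measure.isProbabilityMeasure_map (by fun_prop)
  have iZ : IsProbabilityMeasure (P.map Z) := Measure.isProbabilityMeasure_map (by fun_prop)
  set μ := P.map (fun ω => (U ω, Z ω)) with hμ
  set ν := (P.map U).prod (P.map Z) with hν
  set p : Bool → ℝ := fun b => (P.map U).real {b} with hp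
  have mp : Measurable p := measurable_of_countable _
  set f : Bool × ℝ → ENNReal := fun z => ((P.map U) {z.1})⁻¹ with hf
  have mf : Measurable f :=
    (measurable_of_countable (fun b : Bool => ((P.map U) {b})⁻¹)).comp measurable_fst
  have hne : ∀ b, (P.map U) {b} ≠ 0 := fun b h => by
    have := hpos b; simp [Measure.real, h] at this
  have hle : ∀ S, MeasurableSet S → μ S ≤ ν.withDensity f S := by
    intro S hS
    rw [withDensity_apply _ hS, ← lintegral_indicator hS, hν,
      lintegral_prod _ (mf.indicator hS).aemeasurable, lintegral_fintype]
    have e : ∀ b, (∫⁻ y, S.indicator f (b, y) ∂(P.map Z)) * (P.map U) {b} =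
        (P.map Z) (Prod.mk b ⁻¹' S) := by
      intro b
      have : ∀ y, S.indicator f (b, y) =
          (Prod.mk b ⁻¹' S).indicator (fun _ => ((P.map U) {b})⁻¹) y := by
        intro y
        by_cases hy : (b, y) ∈ S
        · rw [Set.indicator_of_mem hy, Set.indicator_of_mem (by exact hy)]
        · rw [Set.indicator_of_notMem hy, Set.indicator_of_notMem (by exact hy)]
      simp_rw [this]
      rw [lintegral_indicator_const (measurable_prodMk_left hS), mul_right_comm,
        ENNReal.inv_mul_cancel (hne b) (measure_ne_top _ _), one_mul]
    simp_rw [e]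
    rw [Fintype.sum_bool, hμ, Measure.map_apply (by fun_prop) hS,
      Measure.map_apply mZ (measurable_prodMk_left hS),
      Measure.map_apply mZ (measurable_prodMk_left hS)]
    refine (measure_mono ?_).trans (measure_union_le _ _)
    intro ω hω
    change (U ω, Z ω) ∈ S at hω
    rcases hb : U ω with _ | _
    · right; rw [hb] at hω; exact hω
    · left; rw [hb] at hω; exact hω
  have hac : μ ≪ ν := by
    refine Measure.AbsolutelyContinuous.mk fun S hS h0 => ?_
    have := hle S hS
    rw [withDensity_absolutelyContinuous ν f h0] at this
    exact le_antisymm this zero_le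
  have hr : μ.rnDeriv ν ≤ᵐ[ν] f := by
    apply ae_le_of_forall_setLIntegral_le_of_sigmaFinite (Measure.measurable_rnDeriv μ ν)
    intro s hs _
    rw [← withDensity_apply _ hs, ← withDensity_apply _ hs, Measure.withDensity_rnDeriv_eq _ _ hac]
    exact hle s hs
  have hr' : ∀ᵐ z ∂ν, (μ.rnDeriv ν z).toReal ≤ (p z.1)⁻¹ := by
    filter_upwards [hr] with z hz
    have := ENNReal.toReal_mono (ENNReal.inv_ne_top.2 (hne z.1)) hz
    rwa [ENNReal.toReal_inv] at this
  have hint : Integrable (llr μ ν) μ := by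
    rw [← integrable_rnDeriv_smul_iff hac]
    set C := (p true)⁻¹ + (p false)⁻¹ with hC
    have hCb : ∀ b, (p b)⁻¹ ≤ C := by
      intro b
      have h1 := inv_pos.2 (hpos true)
      have h2 := inv_pos.2 (hpos false)
      cases b
      · change _ ≤ (p true)⁻¹ + (p false)⁻¹; change 0 < (p true)⁻¹ at h1; linarith
      · change _ ≤ (p true)⁻¹ + (p false)⁻¹; change 0 < (p false)⁻¹ at h2; linarith
    refine Integrable.of_bound (C := 1 + C ^ 2) ?_ ?_
    · exact ((Measure.measurable_rnDeriv μ ν).ennreal_toReal.mul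
        (measurable_llr μ ν)).aestronglyMeasurable
    · filter_upwards [hr'] with z hz
      have hzC := hz.trans (hCb z.1)
      rw [llr, smul_eq_mul, Real.norm_eq_abs]
      set r := (μ.rnDeriv ν z).toReal with hrr
      have r0 : 0 ≤ r := ENNReal.toReal_nonneg
      rcases r0.eq_or_lt with h | h
      · rw [← h]; simp; positivity
      · rcases le_total r 1 with h1 | h1
        · have := Real.abs_log_mul_self_lt r h h1
          rw [mul_comm] at this
          nlinarith [sq_nonneg C]
        · have hl := Real.log_nonneg h1
          have hl2 : Real.log r ≤ r := (Real.log_le_sub_one_of_pos h).trans (by linarith)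
          rw [abs_of_nonneg (by positivity)]
          nlinarith
  refine ⟨hac, hint, ?_⟩
  have ilp : Integrable (fun b => -Real.log (p b)) (P.map U) := Integrable.of_finite
  have eU : P.map U = μ.map Prod.fst := by
    rw [hμ, Measure.map_map measurable_fst (by fun_prop)]; rfl
  have ilp' : Integrable (fun z : Bool × ℝ => -Real.log (p z.1)) μ := by
    rw [eU] at ilp
    exact ilp.comp_measurable measurable_fst
  have h1 : ∫ z, llr μ ν z ∂μ ≤ ∫ z : Bool × ℝ, -Real.log (p z.1) ∂μ := by
    apply integral_mono_ae hint ilp'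
    filter_upwards [hac.ae_le hr', Measure.rnDeriv_pos hac,
      hac.ae_le (Measure.rnDeriv_lt_top μ ν)] with z h1 h2 h3
    have h4 := ENNReal.toReal_pos h2.ne' h3.ne
    have := Real.log_le_log h4 h1
    rwa [Real.log_inv] at this
  have h2 : ∫ z : Bool × ℝ, -Real.log (p z.1) ∂μ = ∫ b, -Real.log (p b) ∂(P.map U) := by
    conv_rhs => rw [eU]
    exact (integral_map measurable_fst.aemeasurable (measurable_of_countable
      (fun b : Bool => -Real.log (p b))).aestronglyMeasurable).symm
  rw [h2, integral_fintype ilp, Fintype.sum_bool] at h1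
  exact h1

lemma hcg_tail (M : ℝ) (hM : 0 ≤ M) :
    Real.exp (-((M + 1) ^ 2 / 2 + Real.log (2 * Real.pi) / 2)) ≤
      (gaussianReal 0 1).real (Set.Ioi M) := by
  have h2p : 0 < 2 * Real.pi := by positivity
  have hs : Real.exp (-((M + 1) ^ 2 / 2 + Real.log (2 * Real.pi) / 2)) =
      (√(2 * Real.pi))⁻¹ * Real.exp (-(M + 1) ^ 2 / 2) := by
    rw [Real.sqrt_eq_rpow, Real.rpow_def_of_pos h2p, ← Real.exp_neg, ← Real.exp_add]
    congr 1; ring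
  rw [hs, Measure.real, gaussianReal_apply 0 one_ne_zero]
  have : ENNReal.ofReal ((√(2 * Real.pi))⁻¹ * Real.exp (-(M + 1) ^ 2 / 2)) ≤
      ∫⁻ x in Set.Ioi M, gaussianPDF 0 1 x := by
    calc _ = ∫⁻ x in Set.Ioc M (M + 1),
          ENNReal.ofReal ((√(2 * Real.pi))⁻¹ * Real.exp (-(M + 1) ^ 2 / 2)) := by
          simp
      _ ≤ ∫⁻ x in Set.Ioc M (M + 1), gaussianPDF 0 1 x := by
          apply setLIntegral_mono (measurable_gaussianPDF 0 1)
          intro x hx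
          rw [gaussianPDF, gaussianPDFReal_def]
          apply ENNReal.ofReal_le_ofReal
          simp only [NNReal.coe_one, mul_one, sub_zero]
          gcongr
          · linarith [hx.1]
          · exact hx.2
      _ ≤ _ := lintegral_mono_set Set.Ioc_subset_Ioi_self
  have ht : ∫⁻ x in Set.Ioi M, gaussianPDF 0 1 x ≠ ⊤ := by
    rw [← gaussianReal_apply 0 one_ne_zero]; exact measure_ne_top _ _
  exact (ENNReal.ofReal_le_iff_le_toReal ht).1 this

/-- The threshold variable. -/
noncomputable def hcgU (M : ℝ) (q : ℝ × ℝ) : Bool := open Classical in decide (M < q.1)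

lemma hcgU_eq (M : ℝ) : hcgU M = (fun x : ℝ => open Classical in decide (M < x)) ∘ Prod.fst := rfl

lemma hcgT_meas (M : ℝ) : Measurable (fun x : ℝ => open Classical in decide (M < x)) := by
  apply measurable_to_bool
  convert measurableSet_Ioi (a := M)
  ext x; simp

lemma hcgU_meas (M : ℝ) : Measurable (hcgU M) := (hcgT_meas M).comp measurable_fst

lemma hcgU_true (ρ M : ℝ) : ((hcgQ ρ).map (hcgU M)).real {true} =
    (gaussianReal 0 1).real (Set.Ioi M) := by
  rw [Measure.real, Measure.real, hcgU_eq, ← Measure.map_map (hcgT_meas M) measurable_fst, hcgQ,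
    Measure.map_fst_prod, measure_univ, one_smul, Measure.map_apply (hcgT_meas M) (by simp)]
  congr 2
  ext x; simp

lemma hcgU_false (ρ M : ℝ) : ((hcgQ ρ).map (hcgU M)).real {false} =
    1 - (gaussianReal 0 1).real (Set.Ioi M) := by
  have : IsProbabilityMeasure ((hcgQ ρ).map (hcgU M)) :=
    Measure.isProbabilityMeasure_map (hcgU_meas M).aemeasurable
  rw [← hcgU_true ρ M, ← probReal_compl_eq_one_sub (by simp)]
  congr 1
  ext b; simp

lemma hcg_tail_lt (M : ℝ) : (gaussianReal 0 1).real (Set.Ioi M) < 1 := by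
  have h := probReal_compl_eq_one_sub (μ := gaussianReal 0 1) (measurableSet_Ioi (a := M))
  have h2 : 0 < (gaussianReal 0 1).real (Set.Ioi M)ᶜ := by
    rw [Measure.real, ENNReal.toReal_pos_iff]
    refine ⟨pos_iff_ne_zero.2 fun h0 => ?_, measure_lt_top _ _⟩
    have := gaussianReal_absolutelyContinuous' 0 one_ne_zero h0
    simp at this
  linarith

lemma hcg_lowerY (ρ : ℝ) (hρ : ρ ∈ Set.Ioo (-1 : ℝ) 1) (M : ℝ) (hM : 0 ≤ M)
    (hac : (hcgQ ρ).map (fun q => (hcgU M q, ρ * q.1 + q.2)) ≪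
      ((hcgQ ρ).map (hcgU M)).prod ((hcgQ ρ).map (fun q => ρ * q.1 + q.2)))
    (hi : Integrable (llr ((hcgQ ρ).map (fun q => (hcgU M q, ρ * q.1 + q.2)))
      (((hcgQ ρ).map (hcgU M)).prod ((hcgQ ρ).map (fun q => ρ * q.1 + q.2))))
      ((hcgQ ρ).map (fun q => (hcgU M q, ρ * q.1 + q.2)))) :
    (gaussianReal 0 1).real (Set.Ioi M) * (ρ ^ 2 * M ^ 2 / 2) ≤
    ∫ z, llr ((hcgQ ρ).map (fun q => (hcgU M q, ρ * q.1 + q.2)))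
      (((hcgQ ρ).map (hcgU M)).prod ((hcgQ ρ).map (fun q => ρ * q.1 + q.2))) z
      ∂((hcgQ ρ).map (fun q => (hcgU M q, ρ * q.1 + q.2))) := by
  have mU := hcgU_meas M
  have mUY : Measurable (fun q : ℝ × ℝ => (hcgU M q, ρ * q.1 + q.2)) := by fun_prop
  have iμ : IsProbabilityMeasure ((hcgQ ρ).map (fun q => (hcgU M q, ρ * q.1 + q.2))) :=
    Measure.isProbabilityMeasure_map (by fun_prop)
  have iU : IsProbabilityMeasure ((hcgQ ρ).map (hcgU M)) :=
    Measure.isProbabilityMeasure_map (by fun_prop)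
  rw [hcgQ_law ρ hρ] at *
  set h : Bool × ℝ → ℝ := fun z => if z.1 = true then ρ * M * z.2 - (ρ * M) ^ 2 / 2 else 0 with hh
  have mh : Measurable h := by
    apply Measurable.ite (measurable_fst (measurableSet_singleton true)) (by fun_prop) (by fun_prop)
  have i1 : Integrable (fun q : ℝ × ℝ => q.1) (hcgQ ρ) :=
    Integrable.comp_fst ((memLp_id_gaussianReal 1).integrable (by simp)) _
  have i2 : Integrable (fun q : ℝ × ℝ => q.2) (hcgQ ρ) :=
    Integrable.comp_snd ((memLp_id_gaussianReal 1).integrable (by simp)) _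
  have mS : MeasurableSet {q : ℝ × ℝ | M < q.1} := measurable_fst measurableSet_Ioi
  have ehq : ∀ q : ℝ × ℝ, h (hcgU M q, ρ * q.1 + q.2) = {q : ℝ × ℝ | M < q.1}.indicator
      (fun q => ρ * M * (ρ * q.1 + q.2) - (ρ * M) ^ 2 / 2) q := by
    intro q
    by_cases hq : M < q.1
    · rw [Set.indicator_of_mem (by exact hq)]; simp [hh, hcgU, hq]
    · rw [Set.indicator_of_notMem (by exact hq)]; simp [hh, hcgU, hq]
  have ihq : Integrable (fun q : ℝ × ℝ => h (hcgU M q, ρ * q.1 + q.2)) (hcgQ ρ) := by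
    simp_rw [ehq]
    refine Integrable.indicator ?_ mS
    exact (((i1.const_mul ρ).add i2).const_mul (ρ * M)).sub (integrable_const _)
  have ih : Integrable h ((hcgQ ρ).map (fun q => (hcgU M q, ρ * q.1 + q.2))) :=
    (integrable_map_measure mh.aestronglyMeasurable mUY.aemeasurable).2 ihq
  have iexp : Integrable (fun y : ℝ => Real.exp (ρ * M * y - (ρ * M) ^ 2 / 2))
      (gaussianReal 0 1) := by
    simp_rw [Real.exp_sub]
    exact (integrable_exp_mul_gaussianReal (ρ * M)).div_const _
  have ie : Integrable (fun z => Real.exp (h z))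
      (((hcgQ ρ).map (hcgU M)).prod (gaussianReal 0 1)) := by
    have hd : Integrable (fun z : Bool × ℝ => Real.exp (ρ * M * z.2 - (ρ * M) ^ 2 / 2) + 1)
      (((hcgQ ρ).map (hcgU M)).prod (gaussianReal 0 1)) :=
        (iexp.comp_snd _).add (integrable_const _)
    refine hd.mono' (by fun_prop) ?_
    filter_upwards with z
    rw [Real.norm_eq_abs, abs_of_pos (Real.exp_pos _)]
    simp only [hh]
    split_ifs
    · linarith
    · rw [Real.exp_zero]; linarith [Real.exp_pos (ρ * M * z.2 - (ρ * M) ^ 2 / 2)]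
  have e1 : ∫ z, Real.exp (h z) ∂(((hcgQ ρ).map (hcgU M)).prod (gaussianReal 0 1)) ≤ 1 := by
    rw [integral_prod _ ie]
    have : ∀ b, ∫ y, Real.exp (h (b, y)) ∂(gaussianReal 0 1) = 1 := by
      intro b
      cases b
      · simp [hh]
      · simp only [hh, if_true]
        simp_rw [Real.exp_sub]
        rw [integral_div]
        have := mgf_gaussianReal (p := gaussianReal 0 1) (X := id) (Measure.map_id) (ρ * M)
        rw [mgf] at this
        simp only [id] at this
        rw [this, div_eq_one_iff_eq (Real.exp_pos _).ne']
        simp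
    simp_rw [this]
    simp
  refine le_trans ?_ (hcg_dv _ _ hac hi h ih ie e1)
  rw [integral_map mUY.aemeasurable mh.aestronglyMeasurable]
  have ia : Integrable ({q : ℝ × ℝ | M < q.1}.indicator (fun _ => ρ ^ 2 * M ^ 2 / 2)) (hcgQ ρ) :=
    (integrable_const _).indicator mS
  have ib : Integrable (fun q : ℝ × ℝ => (Set.Ioi M).indicator (fun _ => ρ * M) q.1 * q.2)
      (hcgQ ρ) := by
    refine Integrable.mul_prod (f := (Set.Ioi M).indicator (fun _ => ρ * M)) (g := fun w => w) ?_ ?_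
    · exact (integrable_const _).indicator measurableSet_Ioi
    · exact (memLp_id_gaussianReal 1).integrable (by simp)
  have hmono : ∫ q, ({q : ℝ × ℝ | M < q.1}.indicator (fun _ => ρ ^ 2 * M ^ 2 / 2) q +
      (Set.Ioi M).indicator (fun _ => ρ * M) q.1 * q.2) ∂(hcgQ ρ) ≤
      ∫ q : ℝ × ℝ, h (hcgU M q, ρ * q.1 + q.2) ∂(hcgQ ρ) := by
    apply integral_mono (ia.add ib) ihq
    intro q
    change {q : ℝ × ℝ | M < q.1}.indicator (fun _ => ρ ^ 2 * M ^ 2 / 2) q +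
      (Set.Ioi M).indicator (fun _ => ρ * M) q.1 * q.2 ≤ h (hcgU M q, ρ * q.1 + q.2)
    rw [ehq]
    by_cases hq : M < q.1
    · rw [Set.indicator_of_mem (by exact hq), Set.indicator_of_mem (by exact hq),
        Set.indicator_of_mem (by exact hq)]
      have : 0 ≤ ρ ^ 2 * M * (q.1 - M) :=
        mul_nonneg (mul_nonneg (sq_nonneg _) hM) (by linarith)
      nlinarith
    · rw [Set.indicator_of_notMem (by exact hq), Set.indicator_of_notMem (by exact hq),
        Set.indicator_of_notMem (by exact hq)]
      simp
  refine le_trans (le_of_eq ?_) hmono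
  rw [integral_add ia ib, integral_indicator mS]
  have z2 : ∫ q : ℝ × ℝ, (Set.Ioi M).indicator (fun _ => ρ * M) q.1 * q.2 ∂(hcgQ ρ) = 0 := by
    rw [hcgQ, integral_prod_mul (f := (Set.Ioi M).indicator (fun _ => ρ * M)) (g := fun w => w)]
    simp
  rw [z2]
  simp only [integral_const, smul_eq_mul, measureReal_restrict_apply_univ, add_zero]
  congr 1
  rw [hcgQ, Measure.real, Measure.real]
  have : {q : ℝ × ℝ | M < q.1} = (Set.Ioi M) ×ˢ Set.univ := by ext; simp
  rw [this, Measure.prod_prod]; simp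


lemma hcg_kl {α : Type*} [MeasurableSpace α] {μ ν : Measure α} (h1 : μ ≪ ν)
    (h2 : Integrable (llr μ ν) μ) : klDivE μ ν = ((∫ x, llr μ ν x ∂μ : ℝ) : EReal) :=
  if_pos ⟨h1, h2⟩

lemma hcg_kl_fin {α : Type*} [MeasurableSpace α] {μ ν : Measure α} (h : klDivE μ ν < ⊤) :
    μ ≪ ν ∧ Integrable (llr μ ν) μ := by
  by_contra hn
  unfold klDivE at h
  rw [if_neg hn] at h
  exact lt_irrefl _ h

lemma hcg_margX (ρ : ℝ) {Ω : Type*} [MeasurableSpace Ω] (P : Measure Ω) (X Y : Ω → ℝ)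
    (mX : Measurable X) (mY : Measurable Y)
    (hlaw : P.map (fun ω => (X ω, Y ω)) = (hcgQ ρ).map (fun p => (p.1, ρ * p.1 + p.2))) :
    P.map X = gaussianReal 0 1 := by
  have h1 : P.map X = (P.map (fun ω => (X ω, Y ω))).map Prod.fst := by
    rw [Measure.map_map measurable_fst (by fun_prop)]; rfl
  rw [h1, hlaw, Measure.map_map measurable_fst (by fun_prop)]
  change (hcgQ ρ).map Prod.fst = _
  rw [hcgQ, Measure.map_fst_prod]; simp

lemma hcg_margY (ρ : ℝ) (hρ : ρ ∈ Set.Ioo (-1 : ℝ) 1) {Ω : Type*} [MeasurableSpace Ω]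
    (P : Measure Ω) (X Y : Ω → ℝ) (mX : Measurable X) (mY : Measurable Y)
    (hlaw : P.map (fun ω => (X ω, Y ω)) = (hcgQ ρ).map (fun p => (p.1, ρ * p.1 + p.2))) :
    P.map Y = gaussianReal 0 1 := by
  have h1 : P.map Y = (P.map (fun ω => (X ω, Y ω))).map Prod.snd := by
    rw [Measure.map_map measurable_snd (by fun_prop)]; rfl
  rw [h1, hlaw, Measure.map_map measurable_snd (by fun_prop)]
  exact hcgQ_law ρ hρ

lemma hcg_mem_le (ρ : ℝ) (hρ : ρ ∈ Set.Ioo (-1 : ℝ) 1) (hρ0 : ρ ≠ 0) (μ : Measure (ℝ × ℝ))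
    (hμ : μ = (hcgQ ρ).map (fun p => (p.1, ρ * p.1 + p.2))) (w : MarkovWitness μ)
    (h0 : 0 < mutInfoE w.U w.X w.P) (h1 : mutInfoE w.U w.X w.P < ⊤) :
    (mutInfoE w.U w.Y w.P).toReal / (mutInfoE w.U w.X w.P).toReal ≤ ρ ^ 2 := by
  have hlaw := w.law_eq.trans hμ
  obtain ⟨hac, hi⟩ := hcg_kl_fin h1
  have e := hcg_kl hac hi
  have h0' : 0 < (mutInfoE w.U w.X w.P).toReal := EReal.toReal_pos h0 h1.ne
  rw [div_le_iff₀ h0']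
  by_cases hY : mutInfoE w.U w.Y w.P < ⊤
  · obtain ⟨hacY, hiY⟩ := hcg_kl_fin hY
    have eY := hcg_kl hacY hiY
    unfold mutInfoE
    rw [e, eY, EReal.toReal_coe, EReal.toReal_coe]
    exact hcg_upper w.P w.U w.X w.Y w.measU w.measX w.measY ρ hρ hρ0 hlaw w.markov
      (hcg_margX ρ w.P w.X w.Y w.measX w.measY hlaw) (hcg_margY ρ hρ w.P w.X w.Y w.measX w.measY hlaw)
      hac hi hacY hiY
  · rw [not_lt_top_iff.1 hY, EReal.toReal_top]
    positivity

/-- The explicit threshold witness. -/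
noncomputable def hcgW (ρ M : ℝ) (μ : Measure (ℝ × ℝ))
    (hμ : μ = (hcgQ ρ).map (fun p => (p.1, ρ * p.1 + p.2))) : MarkovWitness μ where
  Ω := ℝ × ℝ
  P := hcgQ ρ
  A := Bool
  U := hcgU M
  X := Prod.fst
  Y := fun q => ρ * q.1 + q.2
  measU := hcgU_meas M
  measX := measurable_fst
  measY := by fun_prop
  law_eq := hμ.symm
  markov := by
    apply condIndepFun_of_measurable_left
    · exact (hcgT_meas M).comp (comap_measurable Prod.fst)
    · fun_prop

lemma hcg_mem_ge (ρ : ℝ) (hρ : ρ ∈ Set.Ioo (-1 : ℝ) 1) (hρ0 : ρ ≠ 0) (μ : Measure (ℝ × ℝ))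
    (hμ : μ = (hcgQ ρ).map (fun p => (p.1, ρ * p.1 + p.2))) (n : ℕ) :
    ∃ w : MarkovWitness μ, 0 < mutInfoE w.U w.X w.P ∧ mutInfoE w.U w.X w.P < ⊤ ∧
      ρ ^ 2 * (1 - (4 + 2 * Real.log (2 * Real.pi)) * (1 / ((n : ℝ) + 1))) ≤
      (mutInfoE w.U w.Y w.P).toReal / (mutInfoE w.U w.X w.P).toReal := by
  set M : ℝ := (n : ℝ) + 1 with hM
  have hM0 : 0 < M := by positivity
  refine ⟨hcgW ρ M μ hμ, ?_⟩
  have mU := hcgU_meas M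
  have hp0 : 0 < (gaussianReal 0 1).real (Set.Ioi M) := (Real.exp_pos _).trans_le (hcg_tail M hM0.le)
  have hp1 := hcg_tail_lt M
  have hpos : ∀ b, 0 < ((hcgQ ρ).map (hcgU M)).real {b} := by
    intro b
    cases b
    · rw [hcgU_false]; linarith
    · rw [hcgU_true]; exact hp0
  obtain ⟨hac, hi, hX⟩ := hcg_finite (hcgQ ρ) (hcgU M) Prod.fst mU measurable_fst hpos
  obtain ⟨hacY, hiY, -⟩ := hcg_finite (hcgQ ρ) (hcgU M) (fun q => ρ * q.1 + q.2) mU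
    (by fun_prop) hpos
  have hYl := hcg_lowerY ρ hρ M hM0.le hacY hiY
  have hlaw : (hcgQ ρ).map (fun q : ℝ × ℝ => (q.1, ρ * q.1 + q.2)) =
    (hcgQ ρ).map (fun p => (p.1, ρ * p.1 + p.2)) := rfl
  have hup := hcg_upper (hcgQ ρ) (hcgU M) Prod.fst (fun q => ρ * q.1 + q.2) mU measurable_fst
    (by fun_prop) ρ hρ hρ0 hlaw (hcgW ρ M μ hμ).markov
    (hcg_margX ρ (hcgQ ρ) Prod.fst (fun q => ρ * q.1 + q.2) measurable_fst (by fun_prop) hlaw)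
    (hcgQ_law ρ hρ) hac hi hacY hiY
  have eX : mutInfoE (hcgW ρ M μ hμ).U (hcgW ρ M μ hμ).X (hcgW ρ M μ hμ).P = _ := hcg_kl hac hi
  have eY : mutInfoE (hcgW ρ M μ hμ).U (hcgW ρ M μ hμ).Y (hcgW ρ M μ hμ).P = _ := hcg_kl hacY hiY
  rw [eX, eY, EReal.toReal_coe, EReal.toReal_coe]
  rw [hcgU_true, hcgU_false] at hX
  set IX := ∫ z, llr ((hcgQ ρ).map (fun q => (hcgU M q, Prod.fst q)))
    (((hcgQ ρ).map (hcgU M)).prod ((hcgQ ρ).map Prod.fst)) z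
    ∂((hcgQ ρ).map (fun q => (hcgU M q, Prod.fst q))) with hIX
  set IY := ∫ z, llr ((hcgQ ρ).map (fun q => (hcgU M q, ρ * q.1 + q.2)))
      (((hcgQ ρ).map (hcgU M)).prod ((hcgQ ρ).map (fun q => ρ * q.1 + q.2))) z
      ∂((hcgQ ρ).map (fun q => (hcgU M q, ρ * q.1 + q.2))) with hIY
  have htail := hcg_tail M hM0.le
  set p := (gaussianReal 0 1).real (Set.Ioi M) with hp
  set L := Real.log (2 * Real.pi) with hL
  have hL0 : 0 ≤ L := Real.log_nonneg (by linarith [Real.pi_gt_three])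
  have hρ2 : 0 < ρ ^ 2 := by positivity
  have hIY0 : 0 < IY := lt_of_lt_of_le (by positivity) hYl
  have hIX0 : 0 < IX := by
    by_contra hn
    nlinarith
  refine ⟨EReal.coe_pos.2 hIX0, EReal.coe_lt_top _, ?_⟩
  have hlogp : -Real.log p ≤ (M + 1) ^ 2 / 2 + L / 2 := by
    have := (Real.le_log_iff_exp_le hp0).2 htail
    linarith
  have hlogq : (1 - p) * (-Real.log (1 - p)) ≤ p := by
    have hq : 0 < 1 - p := by linarith
    have := Real.one_sub_inv_le_log_of_pos hq
    have h2 := mul_le_mul_of_nonneg_left this hq.le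
    rw [mul_sub, mul_inv_cancel₀ hq.ne'] at h2
    linarith
  have hXb : IX ≤ p * ((M + 1) ^ 2 / 2 + L / 2 + 1) := by
    have := mul_le_mul_of_nonneg_left hlogp hp0.le
    linarith
  change _ ≤ IY / IX
  rw [le_div_iff₀ hIX0]
  refine le_trans ?_ hYl
  rcases le_total (1 - (4 + 2 * L) * (1 / M)) 0 with hneg | hnn
  · have h1 : ρ ^ 2 * (1 - (4 + 2 * L) * (1 / M)) * IX ≤ 0 :=
      mul_nonpos_of_nonpos_of_nonneg (mul_nonpos_of_nonneg_of_nonpos hρ2.le hneg) hIX0.le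
    exact h1.trans (by positivity)
  · have h1 : ρ ^ 2 * (1 - (4 + 2 * L) * (1 / M)) * IX ≤
        ρ ^ 2 * (1 - (4 + 2 * L) * (1 / M)) * (p * ((M + 1) ^ 2 / 2 + L / 2 + 1)) :=
      mul_le_mul_of_nonneg_left hXb (mul_nonneg hρ2.le hnn)
    refine h1.trans ?_
    have hM1 : 1 ≤ M := by rw [hM]; linarith [(Nat.cast_nonneg n : (0 : ℝ) ≤ n)]
    have key : (1 - (4 + 2 * L) * (1 / M)) * ((M + 1) ^ 2 / 2 + L / 2 + 1) ≤ M ^ 2 / 2 := by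
      have e : (1 - (4 + 2 * L) * (1 / M)) * ((M + 1) ^ 2 / 2 + L / 2 + 1) =
        ((M - (4 + 2 * L)) * ((M + 1) ^ 2 / 2 + L / 2 + 1)) / M := by field_simp
      rw [e, div_le_iff₀ hM0]
      have h5 : 0 ≤ L * (M - 1) := mul_nonneg hL0 (by linarith)
      have h6 : 0 ≤ L * M ^ 2 := by positivity
      nlinarith [sq_nonneg (M - 1), mul_nonneg h5 hM0.le, mul_nonneg hL0 hL0]
    calc _ = ρ ^ 2 * p * ((1 - (4 + 2 * L) * (1 / M)) * ((M + 1) ^ 2 / 2 + L / 2 + 1)) := by ring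
      _ ≤ ρ ^ 2 * p * (M ^ 2 / 2) := mul_le_mul_of_nonneg_left key (by positivity)
      _ = _ := by ring

lemma hcg_main {Ω : Type*} [MeasurableSpace Ω] (P : Measure Ω) [IsProbabilityMeasure P]
    (ρ : ℝ) (hρ : ρ ∈ Set.Ioo (-1 : ℝ) 1) (hρ0 : ρ ≠ 0)
    (X W Y : Ω → ℝ) (hX : Measurable X) (hW : Measurable W)
    (hlawX : P.map X = gaussianReal 0 1)
    (hlawW : P.map W = gaussianReal 0 (Real.toNNReal (1 - ρ ^ 2)))
    (hindep : IndepFun X W P)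
    (hY : Y = fun ω => ρ * X ω + W ω) :
    hc P X Y = ρ ^ 2 := by
  have hμ : P.map (fun ω => (X ω, Y ω)) = (hcgQ ρ).map (fun p => (p.1, ρ * p.1 + p.2)) := by
    have h := (indepFun_iff_map_prod_eq_prod_map_map hX.aemeasurable hW.aemeasurable).1 hindep
    rw [hlawX, hlawW] at h
    rw [hcgQ, ← h, Measure.map_map (by fun_prop) (by fun_prop), hY]
    rfl
  have hle : ∀ t ∈ { t | ∃ w : MarkovWitness (P.map (fun ω => (X ω, Y ω))),
      0 < mutInfoE w.U w.X w.P ∧ mutInfoE w.U w.X w.P < ⊤ ∧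
      t = (mutInfoE w.U w.Y w.P).toReal / (mutInfoE w.U w.X w.P).toReal }, t ≤ ρ ^ 2 := by
    rintro t ⟨w, h0, h1, rfl⟩
    exact hcg_mem_le ρ hρ hρ0 _ hμ w h0 h1
  unfold hc
  apply le_antisymm
  · apply csSup_le _ hle
    obtain ⟨w, h0, h1, -⟩ := hcg_mem_ge ρ hρ hρ0 _ hμ 0
    exact ⟨_, w, h0, h1, rfl⟩
  · have lim : Tendsto (fun n : ℕ => ρ ^ 2 * (1 - (4 + 2 * Real.log (2 * Real.pi)) *
        (1 / ((n : ℝ) + 1)))) atTop (𝓝 (ρ ^ 2 * (1 - (4 + 2 * Real.log (2 * Real.pi)) * 0))) :=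
      tendsto_const_nhds.mul (tendsto_const_nhds.sub
        (tendsto_const_nhds.mul tendsto_one_div_add_atTop_nhds_zero_nat))
    rw [mul_zero, sub_zero, mul_one] at lim
    refine le_of_tendsto' lim fun n => ?_
    obtain ⟨w, h0, h1, h2⟩ := hcg_mem_ge ρ hρ hρ0 _ hμ n
    exact le_csSup_of_le ⟨ρ ^ 2, hle⟩ ⟨w, h0, h1, rfl⟩ h2

end HcgAux

/-- **Hypercontractivity coefficient of jointly Gaussian random variables.**
If `X ∼ N(0,1)` and `Y = ρ X + W` with `W ∼ N(0, 1 - ρ²)` independent of `X`,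
where `ρ ∈ (-1,1)`, `ρ ≠ 0`, then `s(X;Y) = ρ²`; in particular `√(s(X;Y)) = |ρ|`. -/
theorem hc_gaussian {Ω : Type*} [MeasurableSpace Ω] (P : Measure Ω) [IsProbabilityMeasure P]
    (ρ : ℝ) (hρ : ρ ∈ Set.Ioo (-1 : ℝ) 1) (hρ0 : ρ ≠ 0)
    (X W Y : Ω → ℝ) (hX : Measurable X) (hW : Measurable W)
    (hlawX : P.map X = gaussianReal 0 1)
    (hlawW : P.map W = gaussianReal 0 (Real.toNNReal (1 - ρ ^ 2)))
    (hindep : IndepFun X W P)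
    (hY : Y = fun ω => ρ * X ω + W ω) :
    hc P X Y = ρ ^ 2 ∧ Real.sqrt (hc P X Y) = |ρ| := by
  have h := hcg_main P ρ hρ hρ0 X W Y hX hW hlawX hlawW hindep hY
  refine ⟨h, ?_⟩
  rw [h, Real.sqrt_sq_eq_abs]
end

section
/- Let (X,Y) be a pair of real-valued random variables and let X_r be a Borel subset of ℝ with α := P(X ∈ X_r) ∈ (0,1), such that: (i) X and Y are independent conditioned on the event {X ∉ X_r}, and (ii) the conditional law of Y given {X ∈ X_r} equals the conditional law of Y given {X ∉ X_r}. Then the HGR maximal correlation satisfies mCor(X,Y) = √α · mCor(X_r, Y), where mCor(X_r, Y) is the maximal correlation of X and Y computed under the conditional probability measure P(· | X ∈ X_r). -/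
open MeasureTheory Real

/-- The Hirschfeld–Gebelein–Rényi maximal correlation of real-valued random variables `X`, `Y`:
`mCor(X,Y) = sup E[f(X) g(Y)]` over Borel-measurable `f, g : ℝ → ℝ` with `E[f(X)] = E[g(Y)] = 0`,
`E[f(X)²] ≤ 1` and `E[g(Y)²] ≤ 1`. -/
noncomputable def mCor {Ω : Type*} [MeasurableSpace Ω] (P : Measure Ω) (X Y : Ω → ℝ) : ℝ :=
  sSup { t | ∃ f g : ℝ → ℝ, Measurable f ∧ Measurable g ∧
    Integrable (fun ω => f (X ω)) P ∧ Integrable (fun ω => g (Y ω)) P ∧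
    Integrable (fun ω => (f (X ω)) ^ 2) P ∧ Integrable (fun ω => (g (Y ω)) ^ 2) P ∧
    (∫ ω, f (X ω) ∂P) = 0 ∧ (∫ ω, g (Y ω) ∂P) = 0 ∧
    (∫ ω, (f (X ω)) ^ 2 ∂P) ≤ 1 ∧ (∫ ω, (g (Y ω)) ^ 2 ∂P) ≤ 1 ∧
    t = ∫ ω, f (X ω) * g (Y ω) ∂P }

lemma mCor_aux_integrable {Ω : Type*} [MeasurableSpace Ω] (P : Measure Ω)
    [IsProbabilityMeasure P] {s : Set Ω} (hs : 0 < (P s).toReal) (h : Ω → ℝ) :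
    Integrable h (ProbabilityTheory.cond P s) ↔ IntegrableOn h s P := by
  have h0 : P s ≠ 0 := by
    intro h; simp [h] at hs
  unfold ProbabilityTheory.cond IntegrableOn
  exact integrable_smul_measure (by simp) (by simpa using h0)

lemma mCor_aux_integral {Ω : Type*} [MeasurableSpace Ω] (P : Measure Ω)
    [IsProbabilityMeasure P] {s : Set Ω} (hs : 0 < (P s).toReal) (h : Ω → ℝ) :
    ∫ ω in s, h ω ∂P = (P s).toReal * ∫ ω, h ω ∂(ProbabilityTheory.cond P s) := by
  unfold ProbabilityTheory.cond
  rw [integral_smul_measure, ENNReal.toReal_inv, smul_eq_mul, mul_inv_cancel_left₀ hs.ne']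

lemma mCor_aux_mul {Ω : Type*} [MeasurableSpace Ω] {P : Measure Ω} {a b : Ω → ℝ}
    (ha : AEStronglyMeasurable a P) (hb : AEStronglyMeasurable b P)
    (ha2 : Integrable (fun ω => a ω ^ 2) P) (hb2 : Integrable (fun ω => b ω ^ 2) P) :
    Integrable (fun ω => a ω * b ω) P := by
  refine (ha2.add hb2).mono' (ha.mul hb) (Filter.Eventually.of_forall fun ω => ?_)
  simp only [Pi.add_apply, norm_eq_abs]
  rw [abs_le]
  constructor <;> nlinarith [sq_nonneg (a ω + b ω), sq_nonneg (a ω - b ω), sq_nonneg (a ω), sq_nonneg (b ω)]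

lemma mCor_aux_bdd {Ω : Type*} [MeasurableSpace Ω] (P : Measure Ω) (X Y : Ω → ℝ)
    (hX : Measurable X) (hY : Measurable Y) :
  BddAbove { t | ∃ f g : ℝ → ℝ, Measurable f ∧ Measurable g ∧
    Integrable (fun ω => f (X ω)) P ∧ Integrable (fun ω => g (Y ω)) P ∧
    Integrable (fun ω => (f (X ω)) ^ 2) P ∧ Integrable (fun ω => (g (Y ω)) ^ 2) P ∧
    (∫ ω, f (X ω) ∂P) = 0 ∧ (∫ ω, g (Y ω) ∂P) = 0 ∧
    (∫ ω, (f (X ω)) ^ 2 ∂P) ≤ 1 ∧ (∫ ω, (g (Y ω)) ^ 2 ∂P) ≤ 1 ∧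
    t = ∫ ω, f (X ω) * g (Y ω) ∂P } := by
  refine ⟨2, ?_⟩
  rintro t ⟨f, g, hf, hg, -, -, hf2, hg2, -, -, hf1, hg1, rfl⟩
  have h1 := mCor_aux_mul (hf.comp hX).aestronglyMeasurable (hg.comp hY).aestronglyMeasurable hf2 hg2
  calc ∫ ω, f (X ω) * g (Y ω) ∂P ≤ ∫ ω, (f (X ω) ^ 2 + g (Y ω) ^ 2) ∂P := by
        refine integral_mono h1 (hf2.add hg2) fun ω => ?_
        simp only
        nlinarith [sq_nonneg (f (X ω) - g (Y ω)), sq_nonneg (f (X ω)), sq_nonneg (g (Y ω))]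
    _ = _ := integral_add hf2 hg2
    _ ≤ 2 := by linarith

/-- **Maximal correlation under a rare/dominant decomposition.** If `X_r` is a Borel set with
`α = P(X ∈ X_r) ∈ (0,1)`, `X` and `Y` are independent conditioned on `{X ∉ X_r}`, and the
conditional law of `Y` given `{X ∈ X_r}` equals that given `{X ∉ X_r}`, then
`mCor(X,Y) = √α · mCor(X_r,Y)`, the latter computed under `P(· | X ∈ X_r)`. -/
theorem mCor_rare_dominant {Ω : Type*} [MeasurableSpace Ω] (P : Measure Ω)
    [IsProbabilityMeasure P] (X Y : Ω → ℝ) (hX : Measurable X) (hY : Measurable Y)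
    (Xr : Set ℝ) (hXr : MeasurableSet Xr)
    (hα0 : 0 < (P (X ⁻¹' Xr)).toReal) (hα1 : (P (X ⁻¹' Xr)).toReal < 1)
    (hindep : ProbabilityTheory.IndepFun X Y (ProbabilityTheory.cond P (X ⁻¹' Xr)ᶜ))
    (hmarg : (ProbabilityTheory.cond P (X ⁻¹' Xr)).map Y
      = (ProbabilityTheory.cond P (X ⁻¹' Xr)ᶜ).map Y) :
    mCor P X Y
      = Real.sqrt (P (X ⁻¹' Xr)).toReal * mCor (ProbabilityTheory.cond P (X ⁻¹' Xr)) X Y := by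
  have hA : MeasurableSet (X ⁻¹' Xr) := hX hXr
  have hc : (P (X ⁻¹' Xr)ᶜ).toReal = 1 - (P (X ⁻¹' Xr)).toReal := by
    exact probReal_compl_eq_one_sub hA
  have hc0 : 0 < (P (X ⁻¹' Xr)ᶜ).toReal := by linarith
  have hIQ := fun h => mCor_aux_integrable P hα0 h
  have hIR := fun h => mCor_aux_integrable P hc0 h
  have hiQ := fun h => mCor_aux_integral P hα0 h
  have hiR := fun h => mCor_aux_integral P hc0 h
  have hPQ : IsProbabilityMeasure (ProbabilityTheory.cond P (X ⁻¹' Xr)) :=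
    ProbabilityTheory.cond_isProbabilityMeasure (by intro h; simp [h] at hα0)
  set A := X ⁻¹' Xr with hAdef
  set Q := ProbabilityTheory.cond P A with hQ
  set R := ProbabilityTheory.cond P Aᶜ with hR
  set α := (P A).toReal with hαdef
  have hsq : 0 < √α := Real.sqrt_pos.2 hα0
  have hss : √α * √α = α := Real.mul_self_sqrt hα0.le
  -- transfer of integrals in Y
  have hYint : ∀ g : ℝ → ℝ, Measurable g → ∫ ω, g (Y ω) ∂ R = ∫ ω, g (Y ω) ∂Q := by
    intro g hg
    rw [← integral_map hY.aemeasurable hg.aestronglyMeasurable,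
      ← integral_map hY.aemeasurable hg.aestronglyMeasurable, hmarg]
  have hYI : ∀ g : ℝ → ℝ, Measurable g → Integrable (fun ω => g (Y ω)) Q →
      Integrable (fun ω => g (Y ω)) R := by
    intro g hg h
    have := (integrable_map_measure (f := Y) (μ := Q) hg.aestronglyMeasurable hY.aemeasurable).2 h
    rw [hmarg] at this
    exact (integrable_map_measure hg.aestronglyMeasurable hY.aemeasurable).1 this
  have hsplit : ∀ h : Ω → ℝ, Integrable h P →
      ∫ ω, h ω ∂P = α * ∫ ω, h ω ∂Q + (1 - α) * ∫ ω, h ω ∂ R := by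
    intro h hh
    rw [← integral_add_compl hA hh, hiQ, hiR, hc]
  have hYP : ∀ g : ℝ → ℝ, Measurable g → Integrable (fun ω => g (Y ω)) P →
      ∫ ω, g (Y ω) ∂P = ∫ ω, g (Y ω) ∂Q := by
    intro g hg h
    rw [hsplit _ h, hYint g hg]; ring
  have hYIP : ∀ g : ℝ → ℝ, Measurable g → Integrable (fun ω => g (Y ω)) Q →
      Integrable (fun ω => g (Y ω)) P := by
    intro g hg h
    rw [← integrableOn_univ, ← Set.union_compl_self A]
    exact ((hIQ _).1 h).union ((hIR _).1 (hYI g hg h))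
  apply le_antisymm
  · unfold mCor
    refine csSup_le ⟨0, 0, 0, measurable_const, measurable_const, ?_⟩ ?_
    · simp
    rintro t ⟨f, g, hf, hg, hfi, hgi, hf2, hg2, hf0, hg0, hf1, hg1, rfl⟩
    have hQi : ∀ h : Ω → ℝ, Integrable h P → Integrable h Q :=
      fun h hh => (hIQ h).2 hh.integrableOn
    have hfg := mCor_aux_mul (hf.comp hX).aestronglyMeasurable
      (hg.comp hY).aestronglyMeasurable hf2 hg2
    simp only [Function.comp_apply] at hfg
    have hgQ : ∫ ω, g (Y ω) ∂Q = 0 := by rw [← hYP g hg hgi, hg0]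
    have hgR : ∫ ω, g (Y ω) ∂ R = 0 := by rw [hYint g hg, hgQ]
    have hRfg : ∫ ω, f (X ω) * g (Y ω) ∂ R = 0 := by
      have := (hindep.comp hf hg).integral_fun_mul_eq_mul_integral
        (hf.comp hX).aestronglyMeasurable (hg.comp hY).aestronglyMeasurable
      simp only [Function.comp_apply] at this
      rw [this, hgR, mul_zero]
    rw [hsplit _ hfg, hRfg, mul_zero, add_zero]
    set m := ∫ ω, f (X ω) ∂Q with hm
    have hfQ := hQi _ hfi
    have hf2Q := hQi _ hf2
    have hgiQ := hQi _ hgi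
    have hfgQ := hQi _ hfg
    have hf2le : α * ∫ ω, f (X ω) ^ 2 ∂Q ≤ 1 := by
      have h1 := hsplit _ hf2
      have h2 : 0 ≤ ∫ ω, f (X ω) ^ 2 ∂ R := integral_nonneg fun ω => sq_nonneg _
      nlinarith [mul_nonneg (sub_nonneg.2 hα1.le) h2]
    have key : √α * ∫ ω, f (X ω) * g (Y ω) ∂Q ≤ mCor Q X Y := by
      unfold mCor
      refine le_csSup (mCor_aux_bdd Q X Y hX hY) ⟨fun x => √α * (f x - m), g, by fun_prop, hg,
        (hfQ.sub (integrable_const m)).const_mul _, hgiQ, ?_, hQi _ hg2, ?_, hgQ, ?_, ?_, ?_⟩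
      · have : (fun ω => (√α * (f (X ω) - m)) ^ 2)
            = fun ω => α * (f (X ω) ^ 2 - 2 * m * f (X ω) + m ^ 2) := by
          ext ω; rw [mul_pow, Real.sq_sqrt hα0.le]; ring
        simp only [this]
        exact ((hf2Q.sub (hfQ.const_mul _)).add (integrable_const _)).const_mul _
      · rw [integral_const_mul, integral_sub hfQ (integrable_const m)]
        simp [← hm]
      · have : (fun ω => (√α * (f (X ω) - m)) ^ 2)
            = fun ω => α * (f (X ω) ^ 2 - 2 * m * f (X ω) + m ^ 2) := by
          ext ω; rw [mul_pow, Real.sq_sqrt hα0.le]; ring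
        simp only [this]
        have hd : Integrable (fun ω => f (X ω) ^ 2 - 2 * m * f (X ω)) Q :=
          hf2Q.sub (hfQ.const_mul _)
        rw [integral_const_mul, integral_add hd (integrable_const _),
          integral_sub hf2Q (hfQ.const_mul _), integral_const_mul, ← hm]
        simp only [integral_const, probReal_univ, one_smul]
        nlinarith [mul_nonneg hα0.le (sq_nonneg m)]
      · rw [← hYP (fun y => g y ^ 2) (hg.pow_const 2) hg2]; exact hg1
      · have : (fun ω => √α * (f (X ω) - m) * g (Y ω))
            = fun ω => √α * (f (X ω) * g (Y ω) - m * g (Y ω)) := by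
          ext ω; ring
        simp only [this]
        rw [integral_const_mul, integral_sub hfgQ (hgiQ.const_mul _), integral_const_mul, hgQ]
        ring
    calc α * ∫ ω, f (X ω) * g (Y ω) ∂Q = √α * (√α * ∫ ω, f (X ω) * g (Y ω) ∂Q) := by
          rw [← mul_assoc, hss]
      _ ≤ _ := mul_le_mul_of_nonneg_left key hsq.le
  · rw [mul_comm, ← le_div_iff₀ hsq]
    conv_lhs => unfold mCor
    refine csSup_le ⟨0, 0, 0, measurable_const, measurable_const, ?_⟩ ?_
    · simp
    rintro t ⟨f, g, hf, hg, hfi, hgi, hf2, hg2, hf0, hg0, hf1, hg1, rfl⟩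
    rw [le_div_iff₀ hsq]
    unfold mCor
    have e1 : ∀ ω, Xr.indicator (fun x => f x / √α) (X ω)
        = A.indicator (fun ω => f (X ω) / √α) ω := fun ω => rfl
    have e2 : ∀ ω, (A.indicator (fun ω => f (X ω) / √α) ω) ^ 2
        = A.indicator (fun ω => f (X ω) ^ 2 / α) ω := by
      intro ω
      by_cases h : ω ∈ A
      · simp [h, div_pow, Real.sq_sqrt hα0.le]
      · simp [h]
    have e3 : ∀ ω, (A.indicator (fun ω => f (X ω) / √α) ω) * g (Y ω)
        = A.indicator (fun ω => f (X ω) * g (Y ω) / √α) ω := by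
      intro ω
      by_cases h : ω ∈ A
      · simp [h]; ring
      · simp [h]
    have hgP := hYIP g hg hgi
    have hg2P := hYIP (fun y => g y ^ 2) (hg.pow_const 2) hg2
    refine le_csSup (mCor_aux_bdd P X Y hX hY) ⟨Xr.indicator (fun x => f x / √α), g,
      (hf.div_const _).indicator hXr, hg, ?_, hgP, ?_, hg2P, ?_, ?_, ?_, ?_, ?_⟩
    · simp only [e1]
      exact (integrable_indicator_iff hA).2 ((hIQ _).1 (hfi.div_const _))
    · simp only [e1, e2]
      exact (integrable_indicator_iff hA).2 ((hIQ _).1 (hf2.div_const _))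
    · simp only [e1]
      rw [integral_indicator hA, hiQ, integral_div, hf0]; simp
    · rw [hYP g hg hgP, hg0]
    · simp only [e1, e2]
      rw [integral_indicator hA, hiQ, integral_div, mul_div_cancel₀ _ hα0.ne']; exact hf1
    · rw [hYP (fun y => g y ^ 2) (hg.pow_const 2) hg2P]; exact hg1
    · simp only [e1, e3]
      rw [integral_indicator hA, hiQ, integral_div]
      rw [mul_div_assoc', eq_div_iff hsq.ne', mul_assoc, hss, mul_comm]
end

section
/- Let (X,Y) be a pair of real-valued random variables and let X_r be a Borel subset of ℝ with α := P(X ∈ X_r) ∈ (0,1), such that: (i) X and Y are independent conditioned on the event {X ∉ X_r}, and (ii) the conditional law of Y given {X ∈ X_r} equals the conditional law of Y given {X ∉ X_r}. Then for all s, t ∈ ℝ: E[e^{i(sX+tY)}] − E[e^{isX}] E[e^{itY}] = α ( E[e^{i(sX+tY)} | X ∈ X_r] − E[e^{isX} | X ∈ X_r] E[e^{itY} | X ∈ X_r] ), where conditional expectations are taken with respect to the conditional probability measure P(· | X ∈ X_r). -/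
open MeasureTheory Real

/-- **Characteristic-function identity under a rare/dominant decomposition (distance
correlation).** If `X_r` is a Borel set with `α = P(X ∈ X_r) ∈ (0,1)`, `X` and `Y` are
independent conditioned on `{X ∉ X_r}`, and the conditional law of `Y` given `{X ∈ X_r}` equals
that given `{X ∉ X_r}`, then for all `s, t ∈ ℝ`:
`E[e^{i(sX+tY)}] − E[e^{isX}] E[e^{itY}]
  = α (E[e^{i(sX+tY)} | X ∈ X_r] − E[e^{isX} | X ∈ X_r] E[e^{itY} | X ∈ X_r])`. -/
theorem charFun_rare_dominant {Ω : Type*} [MeasurableSpace Ω] (P : Measure Ω)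
    [IsProbabilityMeasure P] (X Y : Ω → ℝ) (hX : Measurable X) (hY : Measurable Y)
    (Xr : Set ℝ) (hXr : MeasurableSet Xr)
    (hα0 : 0 < (P (X ⁻¹' Xr)).toReal) (hα1 : (P (X ⁻¹' Xr)).toReal < 1)
    (hindep : ProbabilityTheory.IndepFun X Y (ProbabilityTheory.cond P (X ⁻¹' Xr)ᶜ))
    (hmarg : (ProbabilityTheory.cond P (X ⁻¹' Xr)).map Y
      = (ProbabilityTheory.cond P (X ⁻¹' Xr)ᶜ).map Y)
    (s t : ℝ) :
    (∫ ω, Complex.exp (Complex.I * ((s * X ω + t * Y ω : ℝ) : ℂ)) ∂P)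
        - (∫ ω, Complex.exp (Complex.I * ((s * X ω : ℝ) : ℂ)) ∂P)
          * (∫ ω, Complex.exp (Complex.I * ((t * Y ω : ℝ) : ℂ)) ∂P)
      = ((P (X ⁻¹' Xr)).toReal : ℂ)
          * ((∫ ω, Complex.exp (Complex.I * ((s * X ω + t * Y ω : ℝ) : ℂ))
                ∂(ProbabilityTheory.cond P (X ⁻¹' Xr)))
            - (∫ ω, Complex.exp (Complex.I * ((s * X ω : ℝ) : ℂ))
                ∂(ProbabilityTheory.cond P (X ⁻¹' Xr)))
              * (∫ ω, Complex.exp (Complex.I * ((t * Y ω : ℝ) : ℂ))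
                ∂(ProbabilityTheory.cond P (X ⁻¹' Xr)))) := by
  have hA : MeasurableSet (X ⁻¹' Xr) := hX hXr
  set A := X ⁻¹' Xr with hAdef
  set α : ℝ := (P A).toReal with hα
  have hA0 : P A ≠ 0 := fun h => by simp [hα, h] at hα0
  have hcα : (P Aᶜ).toReal = 1 - α := by
    have := probReal_compl_eq_one_sub (μ := P) hA
    simpa [Measure.real] using this
  have hAc0 : P Aᶜ ≠ 0 := fun h => by
    rw [h] at hcα
    simp at hcα
    linarith
  have hset : ∀ (B : Set Ω), P B ≠ 0 → ∀ f : Ω → ℂ,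
      ∫ ω in B, f ω ∂P = ((P B).toReal : ℂ) * ∫ ω, f ω ∂(ProbabilityTheory.cond P B) := by
    intro B hB f
    have hB' : ((P B).toReal : ℂ) ≠ 0 := by
      exact_mod_cast (ENNReal.toReal_pos hB (measure_ne_top P B)).ne'
    rw [ProbabilityTheory.cond, integral_smul_measure, ENNReal.toReal_inv, Complex.real_smul,
      Complex.ofReal_inv, ← mul_assoc, mul_inv_cancel₀ hB', one_mul]
  have htot : ∀ g : Ω → ℝ, Measurable g →
      ∫ ω, Complex.exp (Complex.I * ((g ω : ℝ) : ℂ)) ∂P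
        = (α : ℂ) * ∫ ω, Complex.exp (Complex.I * ((g ω : ℝ) : ℂ)) ∂(ProbabilityTheory.cond P A)
          + (1 - (α : ℂ)) *
            ∫ ω, Complex.exp (Complex.I * ((g ω : ℝ) : ℂ)) ∂(ProbabilityTheory.cond P Aᶜ) := by
    intro g hg
    have hint : Integrable (fun ω => Complex.exp (Complex.I * ((g ω : ℝ) : ℂ))) P := by
      refine Integrable.of_bound (C := 1) (by fun_prop) (Filter.Eventually.of_forall fun ω => ?_)
      rw [mul_comm, Complex.norm_exp_ofReal_mul_I]
    rw [← integral_add_compl hA hint, hset A hA0, hset Aᶜ hAc0, hcα]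
    push_cast
    rfl
  have hYeq : ∫ ω, Complex.exp (Complex.I * ((t * Y ω : ℝ) : ℂ)) ∂(ProbabilityTheory.cond P Aᶜ)
      = ∫ ω, Complex.exp (Complex.I * ((t * Y ω : ℝ) : ℂ)) ∂(ProbabilityTheory.cond P A) := by
    have hm : ∀ μ : Measure Ω, ∫ y, Complex.exp (Complex.I * ((t * y : ℝ) : ℂ)) ∂(μ.map Y)
        = ∫ ω, Complex.exp (Complex.I * ((t * Y ω : ℝ) : ℂ)) ∂μ := fun μ =>
      integral_map hY.aemeasurable
        (Continuous.aestronglyMeasurable (by fun_prop))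
    rw [← hm, ← hm, hmarg]
  have hprod : ∫ ω, Complex.exp (Complex.I * ((s * X ω + t * Y ω : ℝ) : ℂ))
        ∂(ProbabilityTheory.cond P Aᶜ)
      = (∫ ω, Complex.exp (Complex.I * ((s * X ω : ℝ) : ℂ)) ∂(ProbabilityTheory.cond P Aᶜ))
        * ∫ ω, Complex.exp (Complex.I * ((t * Y ω : ℝ) : ℂ)) ∂(ProbabilityTheory.cond P Aᶜ) := by
    have := hindep.integral_fun_comp_mul_comp
      (f := fun x : ℝ => Complex.exp (Complex.I * ((s * x : ℝ) : ℂ)))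
      (g := fun y : ℝ => Complex.exp (Complex.I * ((t * y : ℝ) : ℂ)))
      hX.aemeasurable hY.aemeasurable
      (Continuous.aestronglyMeasurable (by fun_prop))
      (Continuous.aestronglyMeasurable (by fun_prop))
    rw [← this]
    congr 1
    funext ω
    rw [← Complex.exp_add, Complex.ofReal_add, mul_add]
  rw [htot _ (by fun_prop), htot (fun ω => s * X ω) (by fun_prop),
    htot (fun ω => t * Y ω) (by fun_prop), hprod, hYeq]
  ring
end

section
/- Let (X,Y) be a pair of real-valued random variables and let X_r be a Borel subset of ℝ with α := P(X ∈ X_r) ∈ (0,1), such that: (i) X and Y are independent conditioned on the event {X ∉ X_r}, and (ii) the conditional law of Y given {X ∈ X_r} equals the conditional law of Y given {X ∉ X_r}. Then MIC(X,Y) ≤ α · MIC(X_r, Y), where MIC(X_r, Y) is the maximal information coefficient computed under the conditional probability measure P(· | X ∈ X_r). -/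
open MeasureTheory ProbabilityTheory Real

/-- The maximal information coefficient of real-valued random variables `X` and `Y`:
`MIC(X,Y) = sup I(q_X(X); q_Y(Y)) / log (min m l)`, the supremum over all `m, l ≥ 2` and all
Borel-measurable quantizers `q_X : ℝ → {1,…,m}`, `q_Y : ℝ → {1,…,l}`. -/
noncomputable def MIC {Ω : Type*} [MeasurableSpace Ω] (P : Measure Ω) (X Y : Ω → ℝ) : ℝ :=
  sSup { t | ∃ (m l : ℕ), 2 ≤ m ∧ 2 ≤ l ∧ ∃ (qX : ℝ → Fin m) (qY : ℝ → Fin l),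
    Measurable qX ∧ Measurable qY ∧
    t = (mutInfoE (fun ω => qX (X ω)) (fun ω => qY (Y ω)) P).toReal
        / Real.log (min (m : ℝ) (l : ℝ)) }

lemma rd_mi_eq {Ω A B : Type*} [MeasurableSpace Ω] [Fintype A] [Fintype B]
    [MeasurableSpace A] [MeasurableSpace B] [MeasurableSingletonClass A]
    [MeasurableSingletonClass B]
    (P : Measure Ω) [IsProbabilityMeasure P] (U : Ω → A) (V : Ω → B)
    (hU : Measurable U) (hV : Measurable V) :
    (mutInfoE U V P).toReal = ∑ i, ∑ j, P.real (U ⁻¹' {i} ∩ V ⁻¹' {j}) *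
      Real.log (P.real (U ⁻¹' {i} ∩ V ⁻¹' {j}) / (P.real (U ⁻¹' {i}) * P.real (V ⁻¹' {j}))) := by
  have hUV : Measurable (fun ω => (U ω, V ω)) := hU.prodMk hV
  have i1 : IsProbabilityMeasure (P.map (fun ω => (U ω, V ω))) :=
    Measure.isProbabilityMeasure_map hUV.aemeasurable
  have i2 : IsProbabilityMeasure (P.map U) := Measure.isProbabilityMeasure_map hU.aemeasurable
  have i3 : IsProbabilityMeasure (P.map V) := Measure.isProbabilityMeasure_map hV.aemeasurable
  have hm : ∀ i j, (P.map (fun ω => (U ω, V ω))) {(i, j)} = P (U ⁻¹' {i} ∩ V ⁻¹' {j}) := by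
    intro i j
    rw [Measure.map_apply hUV (measurableSet_singleton _)]
    congr 1
    ext ω
    simp [Prod.ext_iff]
  have hn : ∀ i j, ((P.map U).prod (P.map V)) {(i, j)} = P (U ⁻¹' {i}) * P (V ⁻¹' {j}) := by
    intro i j
    rw [← Set.singleton_prod_singleton, Measure.prod_prod,
      Measure.map_apply hU (measurableSet_singleton _),
      Measure.map_apply hV (measurableSet_singleton _)]
  have hac : (P.map (fun ω => (U ω, V ω))) ≪ ((P.map U).prod (P.map V)) := by
    intro s hs
    rw [← Set.biUnion_of_singleton s, measure_biUnion_null_iff s.to_countable]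
    rintro ⟨i, j⟩ hx
    have h0 : ((P.map U).prod (P.map V)) {(i, j)} = 0 :=
      measure_mono_null (Set.singleton_subset_iff.2 hx) hs
    rw [hn, mul_eq_zero] at h0
    rw [hm]
    rcases h0 with h | h
    · exact measure_mono_null Set.inter_subset_left h
    · exact measure_mono_null Set.inter_subset_right h
  unfold mutInfoE klDivE
  rw [if_pos ⟨hac, Integrable.of_finite⟩, EReal.toReal_coe,
    integral_fintype Integrable.of_finite, Fintype.sum_prod_type]
  refine Finset.sum_congr rfl fun i _ => Finset.sum_congr rfl fun j _ => ?_
  have e1 : (P.map (fun ω => (U ω, V ω))).real {(i, j)} = P.real (U ⁻¹' {i} ∩ V ⁻¹' {j}) := by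
    rw [Measure.real, hm, Measure.real]
  rw [e1, smul_eq_mul]
  by_cases hz : P (U ⁻¹' {i} ∩ V ⁻¹' {j}) = 0
  · simp [Measure.real, hz]
  congr 1
  rw [llr]
  congr 1
  have hd := Measure.setLIntegral_rnDeriv hac {(i, j)}
  rw [lintegral_singleton, hm, hn] at hd
  have hd' := congrArg ENNReal.toReal hd
  rw [ENNReal.toReal_mul, ENNReal.toReal_mul] at hd'
  have hne : (P (U ⁻¹' {i})).toReal * (P (V ⁻¹' {j})).toReal ≠ 0 := by
    intro h
    rw [h, mul_zero] at hd'
    exact (ENNReal.toReal_ne_zero.2 ⟨hz, measure_ne_top _ _⟩) hd'.symm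
  simp only [Measure.real]
  rw [eq_div_iff hne, hd']

lemma rd_logsum (a b c : ℝ) (ha : 0 ≤ a) (hb : 0 ≤ b) (hc : 0 ≤ c) (hac : c = 0 → a = 0) :
    (a + b) * Real.log ((a + b) / (c + b)) ≤ a * Real.log (a / c) := by
  rcases hc.eq_or_lt with h | hc'
  · have := hac h.symm
    subst this
    subst h
    rcases hb.eq_or_lt with h | h
    · simp [← h]
    · simp [div_self h.ne']
  rcases ha.eq_or_lt with h | ha'
  · subst h
    simp only [zero_add, zero_mul]
    refine mul_nonpos_of_nonneg_of_nonpos hb (Real.log_nonpos (by positivity) ?_)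
    rw [div_le_one (by positivity)]
    linarith
  -- both positive
  have h1 : Real.log ((a + b) / (c + b)) - Real.log (a / c) =
      Real.log (((a + b) * c) / ((c + b) * a)) := by
    rw [← Real.log_div (by positivity) (by positivity)]
    congr 1
    field_simp
  have h2 := Real.log_le_sub_one_of_pos (x := ((a + b) * c) / ((c + b) * a)) (by positivity)
  have h3 := Real.log_le_sub_one_of_pos (x := (a + b) / (c + b)) (by positivity)
  have h4 : a * (((a + b) * c) / ((c + b) * a) - 1) + b * ((a + b) / (c + b) - 1) = 0 := by
    field_simp
    ring
  have h5 := mul_le_mul_of_nonneg_left h2 ha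
  have h6 := mul_le_mul_of_nonneg_left h3 hb
  rw [← h1] at h5
  nlinarith

lemma rd_bound {A B : Type*} [Fintype A] [Fintype B] [Nonempty B] (p : A → B → ℝ) (u : A → ℝ)
    (v : B → ℝ) (hp : ∀ i j, 0 ≤ p i j) (hpu : ∀ i j, p i j ≤ u i)
    (hpv : ∀ i j, p i j ≤ v j)
    (hv : ∀ j, ∑ i, p i j = v j) (h1 : ∑ j, v j = 1) :
    ∑ i, ∑ j, p i j * Real.log (p i j / (u i * v j)) ≤ Real.log (Fintype.card B) := by
  have hB : (0 : ℝ) < Fintype.card B := by exact_mod_cast Fintype.card_pos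
  have key : ∀ i j, p i j * Real.log (p i j / (u i * v j)) ≤
      p i j * (Real.log (Fintype.card B) - 1) + p i j / v j / Fintype.card B := by
    intro i j
    rcases (hp i j).eq_or_lt with h | h
    · simp [← h]
    have hu : 0 < u i := h.trans_le (hpu i j)
    have hvj : 0 < v j := h.trans_le (hpv i j)
    have a1 : Real.log (p i j / (u i * v j)) ≤ Real.log (1 / v j) := by
      apply Real.log_le_log (by positivity)
      rw [div_le_div_iff₀ (by positivity) hvj]
      nlinarith [hpu i j]
    have a2 := Real.log_le_sub_one_of_pos (x := 1 / v j / Fintype.card B) (by positivity)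
    rw [Real.log_div (by positivity) hB.ne'] at a2
    have a3 : p i j / v j / Fintype.card B = p i j * (1 / v j / Fintype.card B) := by ring
    rw [a3, ← mul_add]
    apply mul_le_mul_of_nonneg_left _ h.le
    linarith
  calc _ ≤ ∑ i, ∑ j, (p i j * (Real.log (Fintype.card B) - 1) + p i j / v j / Fintype.card B) :=
        Finset.sum_le_sum fun i _ => Finset.sum_le_sum fun j _ => key i j
    _ = ∑ j, (v j * (Real.log (Fintype.card B) - 1) + v j / v j / Fintype.card B) := by
        rw [Finset.sum_comm]
        refine Finset.sum_congr rfl fun j _ => ?_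
        rw [Finset.sum_add_distrib, ← Finset.sum_mul, ← Finset.sum_div, ← Finset.sum_div, hv]
    _ ≤ ∑ j, (v j * (Real.log (Fintype.card B) - 1) + 1 / Fintype.card B) := by
        gcongr with j
        exact div_self_le_one _
    _ = Real.log (Fintype.card B) := by
        rw [Finset.sum_add_distrib, ← Finset.sum_mul, h1]
        simp [hB.ne']

lemma rd_marg {Ω A : Type*} [MeasurableSpace Ω] [Fintype A] [MeasurableSpace A]
    [MeasurableSingletonClass A] (P : Measure Ω) [IsProbabilityMeasure P] (U : Ω → A)
    (hU : Measurable U) (s : Set Ω) : ∑ i, P.real (U ⁻¹' {i} ∩ s) = P.real s := by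
  classical
  have h := sum_measureReal_preimage_singleton (μ := P.restrict s) (f := U) Finset.univ
    (fun i _ => hU (measurableSet_singleton i)) 
  simp only [Finset.coe_univ, Set.preimage_univ, measureReal_restrict_apply MeasurableSet.univ,
    Set.univ_inter] at h
  rw [← h]
  refine Finset.sum_congr rfl fun i _ => ?_
  rw [measureReal_restrict_apply (hU (measurableSet_singleton i))]

lemma rd_mi_bound {Ω : Type*} [MeasurableSpace Ω] {m l : ℕ} [NeZero m] [NeZero l]
    (P : Measure Ω) [IsProbabilityMeasure P] (U : Ω → Fin m) (V : Ω → Fin l)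
    (hU : Measurable U) (hV : Measurable V) :
    (mutInfoE U V P).toReal ≤ Real.log (min (m : ℝ) l) := by
  rw [rd_mi_eq P U V hU hV]
  have tU : ∑ i, P.real (U ⁻¹' {i}) = 1 := by
    simpa using rd_marg P U hU Set.univ
  have tV : ∑ i, P.real (V ⁻¹' {i}) = 1 := by
    simpa using rd_marg P V hV Set.univ
  rcases min_choice (m : ℝ) l with h | h <;> rw [h]
  · rw [Finset.sum_comm]
    have := rd_bound (fun j i => P.real (U ⁻¹' {i} ∩ V ⁻¹' {j})) (fun j => P.real (V ⁻¹' {j}))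
      (fun i => P.real (U ⁻¹' {i})) (fun _ _ => measureReal_nonneg)
      (fun _ _ => measureReal_mono Set.inter_subset_right)
      (fun _ _ => measureReal_mono Set.inter_subset_left)
      (fun i => by simp_rw [Set.inter_comm (U ⁻¹' {i})]; exact rd_marg P V hV _) tU
    simp only [Fintype.card_fin] at this
    simpa only [mul_comm (P.real (U ⁻¹' _)) (P.real (V ⁻¹' _))] using this
  · have := rd_bound (fun i j => P.real (U ⁻¹' {i} ∩ V ⁻¹' {j})) (fun i => P.real (U ⁻¹' {i}))
      (fun j => P.real (V ⁻¹' {j})) (fun _ _ => measureReal_nonneg)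
      (fun _ _ => measureReal_mono Set.inter_subset_left)
      (fun _ _ => measureReal_mono Set.inter_subset_right)
      (fun j => rd_marg P U hU _) tV
    simpa only [Fintype.card_fin] using this

/-- **Maximal information coefficient under a rare/dominant decomposition.** If `X_r` is a Borel
set with `α = P(X ∈ X_r) ∈ (0,1)`, `X` and `Y` are independent conditioned on `{X ∉ X_r}`, and
the conditional law of `Y` given `{X ∈ X_r}` equals that given `{X ∉ X_r}`, then
`MIC(X,Y) ≤ α · MIC(X_r,Y)`, the latter computed under `P(· | X ∈ X_r)`. -/
theorem MIC_rare_dominant {Ω : Type*} [MeasurableSpace Ω] (P : Measure Ω)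
    [IsProbabilityMeasure P] (X Y : Ω → ℝ) (hX : Measurable X) (hY : Measurable Y)
    (Xr : Set ℝ) (hXr : MeasurableSet Xr)
    (hα0 : 0 < (P (X ⁻¹' Xr)).toReal) (hα1 : (P (X ⁻¹' Xr)).toReal < 1)
    (hindep : IndepFun X Y (ProbabilityTheory.cond P (X ⁻¹' Xr)ᶜ))
    (hmarg : (ProbabilityTheory.cond P (X ⁻¹' Xr)).map Y
      = (ProbabilityTheory.cond P (X ⁻¹' Xr)ᶜ).map Y) :
    MIC P X Y ≤ (P (X ⁻¹' Xr)).toReal * MIC (ProbabilityTheory.cond P (X ⁻¹' Xr)) X Y := by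
  classical
  set S := X ⁻¹' Xr with hS
  have hSm : MeasurableSet S := hX hXr
  set a := (P S).toReal with ha
  have haR : P.real S = a := rfl
  have hcR : P.real Sᶜ = 1 - a := by rw [probReal_compl_eq_one_sub hSm, haR]
  have hS0 : P S ≠ 0 := fun h => by simp [ha, h] at hα0
  have hSc0 : P Sᶜ ≠ 0 := by
    intro h
    rw [Measure.real, h] at hcR
    simp at hcR
    linarith
  have iQ : IsProbabilityMeasure (ProbabilityTheory.cond P S) := cond_isProbabilityMeasure hS0
  have iR : IsProbabilityMeasure (ProbabilityTheory.cond P Sᶜ) := cond_isProbabilityMeasure hSc0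
  set Q := ProbabilityTheory.cond P S with hQ
  set R := ProbabilityTheory.cond P Sᶜ with hR
  have decomp : ∀ T, MeasurableSet T → P.real T = a * Q.real T + (1 - a) * R.real T := by
    intro T hT
    have e1 : a * Q.real T = P.real (S ∩ T) := by
      rw [hQ, Measure.real, cond_apply hSm, ENNReal.toReal_mul, ENNReal.toReal_inv, ← Measure.real, ← Measure.real, haR, mul_inv_cancel_left₀ hα0.ne']
    have e2 : (1 - a) * R.real T = P.real (Sᶜ ∩ T) := by
      rw [hR, Measure.real, cond_apply hSm.compl, ENNReal.toReal_mul, ENNReal.toReal_inv,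
        ← Measure.real, ← Measure.real, hcR, mul_inv_cancel_left₀ (by linarith)]
    rw [e1, e2, Set.inter_comm S, Set.inter_comm Sᶜ, ← Set.sdiff_eq, measureReal_inter_add_sdiff hSm]
  unfold MIC
  apply csSup_le
  · exact ⟨_, 2, 2, le_rfl, le_rfl, fun _ => 0, fun _ => 0, measurable_const, measurable_const, rfl⟩
  rintro t ⟨m, l, hm, hl, qX, qY, hqX, hqY, rfl⟩
  have hlog : 0 < Real.log (min (m : ℝ) l) := by
    apply Real.log_pos
    have h1 : (2 : ℝ) ≤ m := by exact_mod_cast hm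
    have h2 : (2 : ℝ) ≤ l := by exact_mod_cast hl
    have := le_min h1 h2
    linarith
  have hU : Measurable (fun ω => qX (X ω)) := hqX.comp hX
  have hV : Measurable (fun ω => qY (Y ω)) := hqY.comp hY
  have main : (mutInfoE (fun ω => qX (X ω)) (fun ω => qY (Y ω)) P).toReal ≤
      a * (mutInfoE (fun ω => qX (X ω)) (fun ω => qY (Y ω)) Q).toReal := by
    rw [rd_mi_eq P _ _ hU hV, rd_mi_eq Q _ _ hU hV, Finset.mul_sum]
    refine Finset.sum_le_sum fun i _ => ?_
    rw [Finset.mul_sum]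
    refine Finset.sum_le_sum fun j _ => ?_
    set E := (fun ω => qX (X ω)) ⁻¹' {i}
    set F := (fun ω => qY (Y ω)) ⁻¹' {j}
    have hE : MeasurableSet E := hU (measurableSet_singleton i)
    have hF : MeasurableSet F := hV (measurableSet_singleton j)
    have hQF : Q.real F = R.real F := by
      have := congrArg (fun ν => ν.real (qY ⁻¹' {j})) hmarg
      simp only [Measure.real] at this
      rw [Measure.map_apply hY (hqY (measurableSet_singleton j)),
        Measure.map_apply hY (hqY (measurableSet_singleton j))] at this
      exact this
    have hREF : R.real (E ∩ F) = R.real E * R.real F := by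
      have := hindep.measure_inter_preimage_eq_mul (qX ⁻¹' {i}) (qY ⁻¹' {j})
        (hqX (measurableSet_singleton i)) (hqY (measurableSet_singleton j))
      have h' := congrArg ENNReal.toReal this
      rw [ENNReal.toReal_mul] at h'
      exact h'
    have hPF : P.real F = Q.real F := by
      rw [decomp F hF, ← hQF]; ring
    have hEF := decomp (E ∩ F) (hE.inter hF)
    have hPE := decomp E hE
    have key := rd_logsum (a * Q.real (E ∩ F)) ((1 - a) * (R.real E * R.real F))
      (a * (Q.real E * Q.real F)) (by positivity)
      (mul_nonneg (by linarith) (by positivity)) (by positivity) (by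
        intro h
        have h0 : Q.real E * Q.real F = 0 := by
          rcases mul_eq_zero.1 h with h | h
          · linarith
          · exact h
        have : Q.real (E ∩ F) = 0 := by
          rcases mul_eq_zero.1 h0 with h | h
          · exact le_antisymm (h ▸ measureReal_mono Set.inter_subset_left) measureReal_nonneg
          · exact le_antisymm (h ▸ measureReal_mono Set.inter_subset_right) measureReal_nonneg
        rw [this, mul_zero])
    rw [mul_div_mul_left _ _ hα0.ne', mul_assoc] at key
    have e : P.real E * P.real F =
        a * (Q.real E * Q.real F) + (1 - a) * (R.real E * R.real F) := by
      rw [hPF, hPE, ← hQF]; ring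
    rw [e, hEF, hREF]
    exact key
  have hle : (mutInfoE (fun ω => qX (X ω)) (fun ω => qY (Y ω)) Q).toReal /
      Real.log (min (m : ℝ) l) ≤ sSup { t | ∃ (m l : ℕ), 2 ≤ m ∧ 2 ≤ l ∧
        ∃ (qX : ℝ → Fin m) (qY : ℝ → Fin l), Measurable qX ∧ Measurable qY ∧
        t = (mutInfoE (fun ω => qX (X ω)) (fun ω => qY (Y ω)) Q).toReal
        / Real.log (min (m : ℝ) (l : ℝ)) } := by
    refine le_csSup ⟨1, ?_⟩ ⟨m, l, hm, hl, qX, qY, hqX, hqY, rfl⟩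
    rintro t ⟨m, l, hm, hl, qX, qY, hqX, hqY, rfl⟩
    have : NeZero m := ⟨by omega⟩
    have : NeZero l := ⟨by omega⟩
    have hlog : 0 < Real.log (min (m : ℝ) l) := by
      apply Real.log_pos
      have h1 : (2 : ℝ) ≤ m := by exact_mod_cast hm
      have h2 : (2 : ℝ) ≤ l := by exact_mod_cast hl
      have := le_min h1 h2
      linarith
    rw [div_le_one hlog]
    exact rd_mi_bound Q _ _ (hqX.comp hX) (hqY.comp hY)
  calc _ ≤ a * (mutInfoE (fun ω => qX (X ω)) (fun ω => qY (Y ω)) Q).toReal /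
        Real.log (min (m : ℝ) l) := by gcongr
    _ = a * ((mutInfoE (fun ω => qX (X ω)) (fun ω => qY (Y ω)) Q).toReal /
        Real.log (min (m : ℝ) l)) := by ring
    _ ≤ _ := mul_le_mul_of_nonneg_left hle hα0.le
end
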